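/- In the welding setting of Theorem 1, let q(·,t) be the exterior driving function: ∂F(z,t)/∂t = -z·(∂F/∂z)·q(z,t)·τ'(t) on 𝔻*, with q(·,t) holomorphic on 𝔻*, q(z,t) → 1 as z → ∞, Re q(z,t) > 0, and q continuous up to the unit circle. Then at t = 0 the interior and exterior driving functions are related by q(ζ,0) = conj( p( 1 / conj(ζ), 0) ) for every ζ with |ζ| > 1; equivalently, writing p*(z,t) = conj(p(conj(z),t)), one has p*(z,0) = q(1/z,0) for all z ∈ 𝔻. -/

import Mathlib

open Filter Topology Asymptotics

/-- A pointwise convergent, locally bounded family of holomorphic functions converges locally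
uniformly. -/
theorem tendstoLocallyUniformlyOn_of_locally_bounded {ι : Type*} {l : Filter ι} {U : Set ℂ}
    {g : ι → ℂ → ℂ} {g₀ : ℂ → ℂ} (hU : IsOpen U)
    (hg : ∀ᶠ i in l, DifferentiableOn ℂ (g i) U) (hg₀ : ContinuousOn g₀ U)
    (hbdd : ∀ a ∈ U, ∃ R > 0, ∃ K : ℝ, ∀ᶠ i in l, ∀ z ∈ Metric.ball a R, z ∈ U → ‖g i z‖ ≤ K)
    (hlim : ∀ a ∈ U, Tendsto (fun i => g i a) l (𝓝 (g₀ a))) :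
    TendstoLocallyUniformlyOn g g₀ l U := by
  rw [Metric.tendstoLocallyUniformlyOn_iff]
  intro ε hε a ha
  obtain ⟨R₀, hR₀, K, hK⟩ := hbdd a ha
  obtain ⟨R₁, hR₁, hR₁U⟩ := Metric.isOpen_iff.1 hU a ha
  set R := min R₀ R₁
  have hR : 0 < R := lt_min hR₀ hR₁
  have hcont := Metric.continuousAt_iff.1 (hg₀.continuousAt (hU.mem_nhds ha)) (ε / 3) (by positivity)
  obtain ⟨δ, hδ, hδ'⟩ := hcont
  set C : ℝ := 2 * |K| / R
  have hC : 0 ≤ C := by positivity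
  set δ' := min R (min δ (ε / (3 * (C + 1))))
  have hδ'0 : 0 < δ' := by positivity
  refine ⟨Metric.ball a δ', mem_nhdsWithin_of_mem_nhds (Metric.ball_mem_nhds _ hδ'0), ?_⟩
  filter_upwards [hg, hK, Metric.tendsto_nhds.1 (hlim a ha) (ε / 3) (by positivity)]
    with i hi hKi hai z hz
  have hzδ : dist z a < δ' := hz
  have hsub : Metric.ball a R ⊆ U := (Metric.ball_subset_ball (min_le_right _ _)).trans hR₁U
  have hbd : ∀ y ∈ Metric.ball a R, ‖g i y‖ ≤ |K| := fun y hy =>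
    (hKi y (Metric.ball_subset_ball (min_le_left _ _) hy) (hsub hy)).trans (le_abs_self K)
  have hmaps : Set.MapsTo (g i) (Metric.ball a R) (Metric.closedBall (g i a) (2 * |K|)) := by
    intro y hy
    rw [mem_closedBall_iff_norm]
    calc ‖g i y - g i a‖ ≤ ‖g i y‖ + ‖g i a‖ := norm_sub_le _ _
      _ ≤ 2 * |K| := by linarith [hbd y hy, hbd a (Metric.mem_ball_self hR)]
  have h1 := Complex.dist_le_div_mul_dist_of_mapsTo_ball (hi.mono hsub) hmaps
    (Metric.ball_subset_ball (min_le_left _ _) hz)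
  have h2 : C * dist z a < ε / 3 := by
    have h3 : dist z a < ε / (3 * (C + 1)) :=
      hzδ.trans_le ((min_le_right _ _).trans (min_le_right _ _))
    rw [lt_div_iff₀ (by positivity)] at h3
    nlinarith [dist_nonneg (x := z) (y := a)]
  have h4 : dist (g₀ z) (g₀ a) < ε / 3 :=
    hδ' (hzδ.trans_le ((min_le_right _ _).trans (min_le_left _ _)))
  calc dist (g₀ z) (g i z) ≤ dist (g₀ z) (g₀ a) + dist (g₀ a) (g i a) + dist (g i a) (g i z) :=
        dist_triangle4 _ _ _ _
    _ < ε := by rw [dist_comm (g₀ a) (g i a), dist_comm (g i a) (g i z)]; linarith [h1.trans_eq rfl]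

/-- A family of univalent functions that converges pointwise to a univalent function is eventually
uniformly bounded on every compact disc: some disc is eventually covered by the image of a fixed
small disc, hence omitted elsewhere. -/
theorem eventually_bounded_of_injOn {I : Set ℝ} {t₀ : ℝ} (ht₀ : t₀ ∈ I) {f : ℂ → ℝ → ℂ}
    (hd : ∀ t ∈ I, DifferentiableOn ℂ (fun z => f z t) (Metric.ball 0 1))
    (hinj : ∀ t ∈ I, Set.InjOn (fun z => f z t) (Metric.ball 0 1))
    (hc : ∀ z ∈ Metric.ball (0 : ℂ) 1, ContinuousWithinAt (f z) I t₀) {r : ℝ} (hr : r < 1) :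
    ∃ K : ℝ, ∀ᶠ t in 𝓝[I] t₀, ∀ z ∈ Metric.closedBall (0 : ℂ) r, ‖f z t‖ ≤ K := by
  -- Baire: uniform boundedness on some disc inside the disc of radius `1 / 2`.
  have hI : ∀ᶠ t in 𝓝[I] t₀, t ∈ I := self_mem_nhdsWithin
  obtain ⟨z₁, ρ, hρ, hsub, K₁, hK₁⟩ : ∃ z₁ : ℂ, ∃ ρ > 0, Metric.ball z₁ ρ ⊆ Metric.ball 0 (1/2) ∧
      ∃ K : ℝ, ∀ᶠ t in 𝓝[I] t₀, ∀ z ∈ Metric.ball z₁ ρ, ‖f z t‖ ≤ K := by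
    let A : ℕ → Set ℂ := fun n => {z | z ∈ Metric.closedBall (0 : ℂ) (1/2) ∧
      ∀ t ∈ I, dist t t₀ < 1 / ((n : ℝ) + 1) → ‖f z t‖ ≤ n}
    have hsub : Metric.closedBall (0 : ℂ) (1/2) ⊆ Metric.ball 0 1 :=
      Metric.closedBall_subset_ball (by norm_num)
    have hA : ∀ n, IsClosed (A n) := by
      intro n
      have : A n = Metric.closedBall (0 : ℂ) (1/2) ∩ ⋂ t ∈ {t | t ∈ I ∧ dist t t₀ < 1 / ((n : ℝ) + 1)},
          (Metric.closedBall (0 : ℂ) (1/2) ∩ (fun z => f z t) ⁻¹' Metric.closedBall 0 n) := by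
        ext z
        simp only [A, Set.mem_ofPred_eq, Set.mem_inter_iff, Set.mem_iInter, Set.mem_preimage,
          mem_closedBall_zero_iff]
        constructor
        · rintro ⟨h1, h2⟩
          exact ⟨h1, fun t ht => ⟨h1, h2 t ht.1 ht.2⟩⟩
        · rintro ⟨h1, h2⟩
          exact ⟨h1, fun t ht ht' => (h2 t ⟨ht, ht'⟩).2⟩
      rw [this]
      refine Metric.isClosed_closedBall.inter (isClosed_biInter fun t ht => ?_)
      exact ((hd t ht.1).continuousOn.mono hsub).preimage_isClosed_of_isClosed
        Metric.isClosed_closedBall Metric.isClosed_closedBall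
    have hcl : ∀ n, IsClosed (A n ∪ (Metric.ball (0 : ℂ) (1/2))ᶜ) := fun n =>
      (hA n).union Metric.isOpen_ball.isClosed_compl
    have hcov : ⋃ n, (A n ∪ (Metric.ball (0 : ℂ) (1/2))ᶜ) = Set.univ := by
      refine Set.eq_univ_of_forall fun z => ?_
      by_cases hz : z ∈ Metric.ball (0 : ℂ) (1/2)
      · have hz' := Metric.ball_subset_closedBall hz
        have h1 : ∀ᶠ t in 𝓝[I] t₀, ‖f z t‖ < ‖f z t₀‖ + 1 :=
          (hc z (hsub hz')).norm.eventually_lt_const (by linarith)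
        obtain ⟨δ, hδ, h2⟩ := Metric.mem_nhdsWithin_iff.1 h1
        obtain ⟨n₁, hn₁⟩ := exists_nat_one_div_lt hδ
        obtain ⟨n₂, hn₂⟩ := exists_nat_ge (‖f z t₀‖ + 1)
        refine Set.mem_iUnion.2 ⟨max n₁ n₂, Or.inl ⟨hz', fun t ht hdist => ?_⟩⟩
        have h3 : dist t t₀ < δ := by
          refine hdist.trans_le (le_trans ?_ hn₁.le)
          gcongr
          exact le_max_left _ _
        have h4 : ‖f z t‖ < ‖f z t₀‖ + 1 := h2 ⟨h3, ht⟩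
        have h5 : (n₂ : ℝ) ≤ ((max n₁ n₂ : ℕ) : ℝ) := by exact_mod_cast le_max_right _ _
        linarith
      · exact Set.mem_iUnion.2 ⟨0, Or.inr hz⟩
    obtain ⟨z₁, hz₁, hz₁'⟩ := (dense_iUnion_interior_of_closed hcl hcov).exists_mem_open
      Metric.isOpen_ball ⟨(0 : ℂ), Metric.mem_ball_self (by norm_num : (0 : ℝ) < 1/2)⟩
    obtain ⟨n, hn⟩ := Set.mem_iUnion.1 hz₁
    obtain ⟨ρ, hρ, hρ'⟩ := Metric.isOpen_iff.1 (isOpen_interior.inter Metric.isOpen_ball) z₁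
      ⟨hn, hz₁'⟩
    refine ⟨z₁, ρ, hρ, fun z hz => (hρ' hz).2, n, ?_⟩
    filter_upwards [hI, mem_nhdsWithin_of_mem_nhds
      (Metric.ball_mem_nhds t₀ (by positivity : 0 < 1 / ((n : ℝ) + 1)))] with t ht htd z hz
    rcases interior_subset (hρ' hz).1 with h | h
    · exact h.2 t ht htd
    · exact absurd (hρ' hz).2 h
  have hhalf : Metric.ball (0 : ℂ) (1/2) ⊆ Metric.ball 0 1 :=
    Metric.ball_subset_ball (by norm_num)
  have hz₁ : z₁ ∈ Metric.ball (0 : ℂ) 1 := hhalf (hsub (Metric.mem_ball_self hρ))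
  have hlu := tendstoLocallyUniformlyOn_of_locally_bounded (l := 𝓝[I] t₀)
    (g := fun t z => f z t) (g₀ := fun z => f z t₀) (U := Metric.ball z₁ ρ) Metric.isOpen_ball
    (hI.mono fun t ht => (hd t ht).mono (hsub.trans hhalf))
    ((hd t₀ ht₀).continuousOn.mono (hsub.trans hhalf))
    (fun a _ => ⟨1, one_pos, K₁, hK₁.mono fun t ht z _ hz => ht z hz⟩)
    (fun a ha => hc a (hhalf (hsub ha)))
  -- On the circle of radius `ρ / 2` around `z₁`, `f` stays away from its central value.
  set ρ' := ρ / 2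
  have hρ' : 0 < ρ' := by positivity
  have hcb : Metric.closedBall z₁ ρ' ⊆ Metric.ball z₁ ρ :=
    Metric.closedBall_subset_ball (half_lt_self hρ)
  have hcb1 : Metric.closedBall z₁ ρ' ⊆ Metric.ball (0 : ℂ) 1 := hcb.trans (hsub.trans hhalf)
  have hSne : (Metric.sphere z₁ ρ').Nonempty := NormedSpace.sphere_nonempty.2 hρ'.le
  obtain ⟨y, hy, hymin⟩ := (isCompact_sphere z₁ ρ').exists_isMinOn hSne
    (f := fun z => ‖f z t₀ - f z₁ t₀‖)
    (((hd t₀ ht₀).continuousOn.mono (Metric.sphere_subset_closedBall.trans hcb1)).sub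
      continuousOn_const).norm
  set ε := ‖f y t₀ - f z₁ t₀‖ / 3
  have hε : 0 < ε := by
    have : f y t₀ ≠ f z₁ t₀ := fun h => by
      have := hinj t₀ ht₀ (hcb1 (Metric.sphere_subset_closedBall hy)) hz₁ h
      rw [this, Metric.mem_sphere, dist_self] at hy
      exact hρ'.ne hy
    have := norm_pos_iff.2 (sub_ne_zero.2 this)
    positivity
  have hunif := (tendstoLocallyUniformlyOn_iff_tendstoUniformlyOn_of_compact
    (isCompact_closedBall z₁ ρ')).1 (hlu.mono hcb)
  have hcov : ∀ᶠ t in 𝓝[I] t₀, Metric.ball (f z₁ t) (ε / 2) ⊆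
      (fun z => f z t) '' Metric.closedBall z₁ ρ' := by
    filter_upwards [hI, Metric.tendstoUniformlyOn_iff.1 hunif ε hε] with t ht htu
    refine DiffContOnCl.ball_subset_image_closedBall
      (((hd t ht).mono hcb1).diffContOnCl_ball subset_rfl) hρ' (fun z hz => ?_) ?_
    · have h1 := htu z (Metric.sphere_subset_closedBall hz)
      have h2 := htu z₁ (Metric.mem_closedBall_self hρ'.le)
      have h3 : 3 * ε ≤ ‖f z t₀ - f z₁ t₀‖ := by
        have : ‖f y t₀ - f z₁ t₀‖ ≤ ‖f z t₀ - f z₁ t₀‖ := hymin hz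
        simp only [ε]; linarith
      rw [dist_eq_norm] at h1 h2
      have h4 : f z t₀ - f z₁ t₀ = (f z t₀ - f z t) + (f z t - f z₁ t) - (f z₁ t₀ - f z₁ t) := by
        ring
      have h5 := norm_sub_le ((f z t₀ - f z t) + (f z t - f z₁ t)) (f z₁ t₀ - f z₁ t)
      have h6 := norm_add_le (f z t₀ - f z t) (f z t - f z₁ t)
      rw [← h4] at h5
      linarith
    · refine Eventually.frequently (f := 𝓝[≠] z₁) ?_ |>.filter_mono nhdsWithin_le_nhds
      filter_upwards [self_mem_nhdsWithin,
        mem_nhdsWithin_of_mem_nhds (Metric.isOpen_ball.mem_nhds hz₁)] with z hz hz' h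
      exact hz (hinj t ht hz' hz₁ h)
  -- Hence `1 / (f - f z₁)` is bounded outside that disc.
  set U : Set ℂ := Metric.ball 0 1 \ Metric.closedBall z₁ ρ'
  have hU : IsOpen U := Metric.isOpen_ball.sdiff Metric.isClosed_closedBall
  have hUne : ∀ t ∈ I, ∀ z ∈ U, f z t - f z₁ t ≠ 0 := fun t ht z hz h => by
    have := hinj t ht hz.1 hz₁ (sub_eq_zero.1 h)
    exact hz.2 (this ▸ Metric.mem_closedBall_self hρ'.le)
  have hdk : ∀ t ∈ I, DifferentiableOn ℂ (fun z => (f z t - f z₁ t)⁻¹) U := fun t ht =>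
    (((hd t ht).mono Set.sdiff_subset).sub_const _).inv (hUne t ht)
  have hluk := tendstoLocallyUniformlyOn_of_locally_bounded (l := 𝓝[I] t₀)
    (g := fun t z => (f z t - f z₁ t)⁻¹) (g₀ := fun z => (f z t₀ - f z₁ t₀)⁻¹) hU
    (hI.mono hdk) (hdk t₀ ht₀).continuousOn
    (fun a _ => ⟨1, one_pos, (ε / 2)⁻¹, by
      filter_upwards [hI, hcov] with t ht htc z _ hz
      rw [norm_inv]
      refine inv_anti₀ (by positivity) ?_
      by_contra! hlt
      obtain ⟨x, hx, hxz⟩ := htc (mem_ball_iff_norm.2 hlt)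
      exact hz.2 (hinj t ht (hcb1 hx) hz.1 hxz ▸ hx)⟩)
    (fun a ha => ((hc a ha.1).sub (hc z₁ hz₁)).inv₀ (hUne t₀ ht₀ a ha))
  -- Evaluate on a circle of radius `s < 1` surrounding everything.
  obtain ⟨s, hs, hs1⟩ := exists_between (max_lt hr (by norm_num : (1/2 : ℝ) < 1))
  have hsr : r < s := (le_max_left _ _).trans_lt hs
  have hs2 : 1/2 < s := (le_max_right _ _).trans_lt hs
  have hs0 : 0 < s := by linarith
  have hSU : Metric.sphere (0 : ℂ) s ⊆ U := fun z hz => by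
    refine ⟨Metric.sphere_subset_ball hs1 hz, fun h => ?_⟩
    have h1 := hsub (hcb h)
    rw [mem_ball_zero_iff] at h1
    rw [mem_sphere_zero_iff_norm] at hz
    linarith
  obtain ⟨y', hy', hymin'⟩ := (isCompact_sphere (0 : ℂ) s).exists_isMinOn
    (NormedSpace.sphere_nonempty.2 hs0.le)
    (f := fun z => ‖(f z t₀ - f z₁ t₀)⁻¹‖) ((hdk t₀ ht₀).continuousOn.mono hSU).norm
  set c := ‖(f y' t₀ - f z₁ t₀)⁻¹‖
  have hc0 : 0 < c := norm_pos_iff.2 (inv_ne_zero (hUne t₀ ht₀ y' (hSU hy')))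
  have hunif' := (tendstoLocallyUniformlyOn_iff_tendstoUniformlyOn_of_compact
    (isCompact_sphere (0 : ℂ) s)).1 (hluk.mono hSU)
  refine ⟨K₁ + (c / 2)⁻¹, ?_⟩
  filter_upwards [hI, hK₁, Metric.tendstoUniformlyOn_iff.1 hunif' (c / 2) (by positivity)]
    with t ht htK htu z hz
  have hsb : Metric.closedBall (0 : ℂ) s ⊆ Metric.ball 0 1 := Metric.closedBall_subset_ball hs1
  refine Complex.norm_le_of_forall_mem_frontier_norm_le (f := fun z => f z t)
    (U := Metric.ball 0 s) Metric.isBounded_ball ((hd t ht).diffContOnCl_ball hsb)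
    (fun x hx => ?_) (subset_closure (Metric.closedBall_subset_ball hsr hz))
  rw [frontier_ball _ hs0.ne'] at hx
  have h1 := htu x hx
  have h2 : c ≤ ‖(f x t₀ - f z₁ t₀)⁻¹‖ := hymin' hx
  have h3 : c / 2 ≤ ‖(f x t - f z₁ t)⁻¹‖ := by
    rw [dist_eq_norm] at h1
    have := norm_sub_norm_le (f x t₀ - f z₁ t₀)⁻¹ (f x t - f z₁ t)⁻¹
    linarith
  have h4 : ‖f x t - f z₁ t‖ ≤ (c / 2)⁻¹ := by
    rw [norm_inv] at h3
    exact le_inv_of_le_inv₀ (by positivity) h3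
  have h5 := htK z₁ (Metric.mem_ball_self hρ)
  calc ‖f x t‖ = ‖f z₁ t + (f x t - f z₁ t)‖ := by ring_nf
    _ ≤ _ := (norm_add_le _ _).trans (add_le_add h5 h4)

/-- A real function that is negative before time `t` and nonnegative at time `t` has nonnegative
left derivative there. -/
theorem deriv_nonneg_of_neg_left {φ : ℝ → ℝ} {φ' t : ℝ} (ht : 0 < t)
    (hφ : HasDerivWithinAt φ φ' (Set.Icc 0 t) t) (hneg : ∀ s ∈ Set.Ico 0 t, φ s < 0)
    (h0 : 0 ≤ φ t) : 0 ≤ φ' := by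
  have h1 : HasDerivWithinAt φ φ' (Set.Ico 0 t) t := hφ.mono Set.Ico_subset_Icc_self
  rw [hasDerivWithinAt_iff_tendsto_slope' (by simp)] at h1
  have : (𝓝[Set.Ico 0 t] t).NeBot := by
    rw [nhdsWithin_Ico_eq_nhdsLT ht]; infer_instance
  refine ge_of_tendsto h1 ?_
  filter_upwards [self_mem_nhdsWithin] with s hs
  rw [slope_def_field]
  have := hneg s hs
  exact div_nonneg_of_nonpos (by linarith) (by linarith [hs.2])

/-- At a maximum point of `‖g‖` on a disc, the derivative of `‖g‖ ^ 2` in an inward direction is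
nonpositive. -/
theorem inner_deriv_nonpos_of_isMaxOn {g : ℂ → ℂ} {g' z a : ℂ} {r : ℝ}
    (hz : z ∈ Metric.closedBall (0 : ℂ) r)
    (hmax : ∀ y ∈ Metric.closedBall (0 : ℂ) r, ‖g y‖ ≤ ‖g z‖) (hg : HasDerivAt g g' z)
    (ha : 0 < a.re) : inner ℝ (g z) (-(z * g' * a)) ≤ 0 := by
  have hγ : HasDerivAt (fun h : ℝ => z - h * (z * a)) (-(z * a)) 0 := by
    have := ((Complex.ofRealCLM.hasDerivAt (x := (0 : ℝ))).mul_const (z * a)).const_sub z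
    simpa using this
  have hcomp : HasDerivAt (fun h : ℝ => g (z - h * (z * a))) (g' * -(z * a)) 0 := by
    refine HasDerivAt.comp (h₂ := g) (0 : ℝ) ?_ hγ
    simpa using hg
  have hsq := hcomp.norm_sq
  have h1 := hsq.hasDerivWithinAt (s := Set.Ioi 0)
  rw [hasDerivWithinAt_iff_tendsto_slope' (by simp)] at h1
  have h2 : ∀ᶠ h : ℝ in 𝓝[>] 0, ‖1 - (h : ℂ) * a‖ ≤ 1 := by
    have h3 : ∀ᶠ h : ℝ in 𝓝[>] 0, h * ‖a‖ ^ 2 < 2 * a.re := by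
      have : Tendsto (fun h : ℝ => h * ‖a‖ ^ 2) (𝓝[>] 0) (𝓝 (0 * ‖a‖ ^ 2)) :=
        (continuous_id.mul continuous_const).continuousAt.tendsto.mono_left nhdsWithin_le_nhds
      exact this.eventually_lt_const (by linarith)
    filter_upwards [h3, self_mem_nhdsWithin] with h hh hpos
    have hpos : 0 < h := hpos
    refine abs_le_of_sq_le_sq' ?_ zero_le_one |>.2
    rw [Complex.sq_norm, Complex.normSq_apply] at *
    simp only [Complex.sub_re, Complex.sub_im, Complex.mul_re, Complex.mul_im, Complex.ofReal_re,
      Complex.ofReal_im, Complex.one_re, Complex.one_im]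
    nlinarith [mul_lt_mul_of_pos_left hh hpos]
  have h4 : 2 * inner ℝ (g (z - (0 : ℝ) * (z * a))) (g' * -(z * a)) ≤ 0 := by
    refine le_of_tendsto h1 ?_
    filter_upwards [h2, self_mem_nhdsWithin] with h hh hpos
    have hpos : 0 < h := hpos
    rw [slope_def_field]
    refine div_nonpos_of_nonpos_of_nonneg ?_ (by linarith)
    have h5 : z - h * (z * a) ∈ Metric.closedBall (0 : ℂ) r := by
      rw [mem_closedBall_zero_iff] at hz ⊢
      calc ‖z - h * (z * a)‖ = ‖z‖ * ‖1 - (h : ℂ) * a‖ := by rw [← norm_mul]; ring_nf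
        _ ≤ ‖z‖ * 1 := by gcongr
        _ ≤ r := by linarith
    have h6 := hmax _ h5
    have h7 : ‖g (z - h * (z * a))‖ ^ 2 ≤ ‖g z‖ ^ 2 := by gcongr
    simpa using h7
  have h8 : g' * -(z * a) = -(z * g' * a) := by ring
  rw [h8] at h4
  simp only [Complex.ofReal_zero, zero_mul, sub_zero] at h4
  linarith

/-- Maximum principle for the transport equation `∂e/∂t = -z (∂e/∂z) p + ρ` on a disc, when the
vector field `-z p` points inwards. -/
theorem norm_le_of_transport {e : ℂ → ℝ → ℂ} {r t₁ R : ℝ} (hR : 0 ≤ R)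
    (hcont : ContinuousOn (Function.uncurry e) (Metric.closedBall 0 r ×ˢ Set.Icc 0 t₁))
    (h0 : ∀ z ∈ Metric.closedBall (0 : ℂ) r, e z 0 = 0)
    (hpde : ∀ z ∈ Metric.closedBall (0 : ℂ) r, ∀ t ∈ Set.Ioc 0 t₁, ∃ ez p ρ : ℂ,
      HasDerivAt (fun x => e x t) ez z ∧ 0 < p.re ∧ ‖ρ‖ ≤ R ∧
      HasDerivWithinAt (e z) (-(z * ez * p) + ρ) (Set.Icc 0 t₁) t) :
    ∀ z ∈ Metric.closedBall (0 : ℂ) r, ∀ t ∈ Set.Icc 0 t₁, ‖e z t‖ ≤ R * t := by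
  intro z₀ hz₀ τ hτ
  suffices H : ∀ ε > 0, ‖e z₀ τ‖ ≤ (R + ε) * τ + ε by
    have hlim : Tendsto (fun ε : ℝ => (R + ε) * τ + ε) (𝓝[>] 0) (𝓝 ((R + 0) * τ + 0)) :=
      (((continuous_const.add continuous_id).mul continuous_const).add
        continuous_id).continuousAt.tendsto.mono_left nhdsWithin_le_nhds
    have := ge_of_tendsto hlim (by filter_upwards [self_mem_nhdsWithin] with ε hε using H ε hε)
    simpa using this
  intro ε hε
  by_contra! hbad
  set b : ℝ → ℝ := fun t => (R + ε) * t + ε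
  have hb : Continuous b := by fun_prop
  -- The first time at which the bound is reached.
  set S := {x ∈ Metric.closedBall (0 : ℂ) r ×ˢ Set.Icc 0 t₁ |
    b x.2 ≤ ‖Function.uncurry e x‖}
  have hK : IsCompact (Metric.closedBall (0 : ℂ) r ×ˢ Set.Icc 0 t₁) :=
    (isCompact_closedBall _ _).prod isCompact_Icc
  have hSc : IsCompact S := by
    refine hK.of_isClosed_subset ?_ (fun x hx => hx.1)
    exact hK.isClosed.isClosed_le (hb.comp continuous_snd).continuousOn hcont.norm
  obtain ⟨⟨w, t⟩, hwt, hmin⟩ := hSc.exists_isMinOn ⟨(z₀, τ), ⟨hz₀, hτ⟩, hbad.le⟩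
    (f := fun x => x.2) continuous_snd.continuousOn
  have hmin' : ∀ s ∈ Set.Ico 0 t, ∀ z ∈ Metric.closedBall (0 : ℂ) r, ‖e z s‖ < b s := by
    intro s hs z hz
    by_contra! h
    have : t ≤ s := hmin (show (z, s) ∈ S from ⟨⟨hz, hs.1, hs.2.le.trans hwt.1.2.2⟩, h⟩)
    linarith [hs.2]
  have htI : t ∈ Set.Icc 0 t₁ := hwt.1.2
  have hslice : ContinuousOn (fun z => e z t) (Metric.closedBall (0 : ℂ) r) :=
    hcont.comp (f := fun z => (z, t)) (by fun_prop) fun z hz => ⟨hz, htI⟩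
  obtain ⟨z, hz, hzmax⟩ := (isCompact_closedBall (0 : ℂ) r).exists_isMaxOn ⟨w, hwt.1.1⟩ hslice.norm
  have hzb : b t ≤ ‖e z t‖ := le_trans hwt.2 (hzmax hwt.1.1)
  have htpos : 0 < t := by
    rcases htI.1.eq_or_lt with h | h
    · rw [← h, h0 z hz, norm_zero] at hzb
      simp only [b] at hzb
      linarith
    · exact h
  obtain ⟨ez, p, ρ, hez, hp, hρ, hder⟩ := hpde z hz t ⟨htpos, htI.2⟩
  have hder' := hder.mono (Set.Icc_subset_Icc_right htI.2)
  have hbt : 0 < b t := by positivity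
  have heq : ‖e z t‖ ≤ b t := by
    have : (𝓝[Set.Ico 0 t] t).NeBot := by
      rw [nhdsWithin_Ico_eq_nhdsLT htpos]; infer_instance
    refine le_of_tendsto_of_tendsto
      (hder'.continuousWithinAt.mono Set.Ico_subset_Icc_self).norm
      (hb.continuousWithinAt (s := Set.Ico 0 t)) ?_
    filter_upwards [self_mem_nhdsWithin] with s hs using (hmin' s hs z hz).le
  have hbder : HasDerivWithinAt b (R + ε) (Set.Icc 0 t) t := by
    have := ((((hasDerivAt_id' t).const_mul (R + ε)).add_const ε).hasDerivWithinAt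
      (s := Set.Icc 0 t))
    rwa [mul_one] at this
  have hφ := hder'.norm_sq.sub (hbder.pow 2)
  have h1 := deriv_nonneg_of_neg_left htpos hφ (fun s hs => by
      have := hmin' s hs z hz
      have h3 : ‖e z s‖ ^ 2 < b s ^ 2 := by gcongr
      simpa using h3) (by
      have h3 : b t ^ 2 ≤ ‖e z t‖ ^ 2 := by gcongr
      simpa using h3)
  have h2 := inner_deriv_nonpos_of_isMaxOn (g := fun x => e x t) hz (fun y hy => hzmax hy) hez hp
  have h3 : inner ℝ (e z t) ρ ≤ b t * R :=
    (real_inner_le_norm _ _).trans (mul_le_mul heq hρ (norm_nonneg _) hbt.le)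
  rw [inner_add_right] at h1
  simp only [Nat.cast_ofNat, Nat.add_one_sub_one, pow_one] at h1
  nlinarith [mul_pos hbt hε]

/-- An equi-Lipschitz family on the closed unit disc that depends continuously on a parameter
pointwise does so uniformly. -/
theorem eventually_uniform_of_lipschitz {I : Set ℝ} {t₀ : ℝ} (ht₀ : t₀ ∈ I) {p : ℂ → ℝ → ℂ}
    {K : NNReal}
    (hLip : ∀ t ∈ I, LipschitzOnWith K (fun z => p z t) (Metric.closedBall 0 1))
    (hc : ∀ z ∈ Metric.closedBall (0 : ℂ) 1, ContinuousWithinAt (p z) I t₀) {ε : ℝ} (hε : 0 < ε) :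
    ∀ᶠ t in 𝓝[I] t₀, ∀ z ∈ Metric.closedBall (0 : ℂ) 1, ‖p z t - p z t₀‖ < ε := by
  have hlu : TendstoLocallyUniformlyOn (fun t z => p z t) (fun z => p z t₀) (𝓝[I] t₀)
      (Metric.closedBall 0 1) := by
    rw [Metric.tendstoLocallyUniformlyOn_iff]
    intro η hη a ha
    set δ : ℝ := η / (3 * (K + 1))
    have hδ : 0 < δ := by positivity
    have hKδ : K * δ < η / 3 := by
      have : δ * (3 * ((K : ℝ) + 1)) = η := div_mul_cancel₀ _ (by positivity)
      nlinarith [K.coe_nonneg]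
    refine ⟨Metric.ball a δ ∩ Metric.closedBall 0 1,
      Filter.inter_mem (mem_nhdsWithin_of_mem_nhds (Metric.ball_mem_nhds _ hδ))
        self_mem_nhdsWithin, ?_⟩
    filter_upwards [self_mem_nhdsWithin, Metric.tendsto_nhds.1 (hc a ha) (η / 3) (by positivity)]
      with t ht hta z hz
    have hza : K * dist z a ≤ K * δ := by
      have : dist z a < δ := hz.1
      gcongr
    have h1 := (hLip t ht).dist_le_mul z hz.2 a ha
    have h2 := (hLip t₀ ht₀).dist_le_mul z hz.2 a ha
    calc dist (p z t₀) (p z t) ≤ dist (p z t₀) (p a t₀) + dist (p a t₀) (p a t) +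
          dist (p a t) (p z t) := dist_triangle4 _ _ _ _
      _ < η := by rw [dist_comm (p a t₀) (p a t), dist_comm (p a t) (p z t)]; linarith
  have hu := (tendstoLocallyUniformlyOn_iff_tendstoUniformlyOn_of_compact
    (isCompact_closedBall (0 : ℂ) 1)).1 hlu
  filter_upwards [Metric.tendstoUniformlyOn_iff.1 hu ε hε] with t ht z hz
  rw [← dist_eq_norm, dist_comm]
  exact ht z hz

/-- A function continuous on the closed unit disc whose derivative is bounded inside is
Lipschitz on the closed disc. -/
theorem lipschitzOnWith_closedBall_of_hasDerivAt {g g' : ℂ → ℂ} {K : NNReal}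
    (hc : ContinuousOn g (Metric.closedBall 0 1))
    (hg : ∀ z ∈ Metric.ball (0 : ℂ) 1, HasDerivAt g (g' z) z)
    (hK : ∀ z ∈ Metric.ball (0 : ℂ) 1, ‖g' z‖ ≤ K) :
    LipschitzOnWith K g (Metric.closedBall 0 1) := by
  rw [← closure_ball (0 : ℂ) one_ne_zero] at hc ⊢
  exact ((convex_ball (0 : ℂ) 1).lipschitzOnWith_of_nnnorm_hasDerivWithin_le
    (fun z hz => (hg z hz).hasDerivWithinAt) hK).closure hc

/-- A family of univalent functions, continuous in the parameter pointwise, is jointly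
continuous. -/
theorem continuousOn_uncurry_of_injOn {I : Set ℝ} {f : ℂ → ℝ → ℂ}
    (hd : ∀ t ∈ I, DifferentiableOn ℂ (fun z => f z t) (Metric.ball 0 1))
    (hinj : ∀ t ∈ I, Set.InjOn (fun z => f z t) (Metric.ball 0 1))
    (hc : ∀ z ∈ Metric.ball (0 : ℂ) 1, ContinuousOn (f z) I) :
    ContinuousOn (Function.uncurry f) (Metric.ball 0 1 ×ˢ I) := by
  rintro ⟨z₀, t₀⟩ ⟨hz₀, ht₀⟩
  have hI : ∀ᶠ t in 𝓝[I] t₀, t ∈ I := self_mem_nhdsWithin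
  have hlu := tendstoLocallyUniformlyOn_of_locally_bounded (l := 𝓝[I] t₀)
    (g := fun t z => f z t) (g₀ := fun z => f z t₀) (U := Metric.ball 0 1) Metric.isOpen_ball
    (hI.mono hd) (hd t₀ ht₀).continuousOn
    (fun a ha => by
      rw [mem_ball_zero_iff] at ha
      obtain ⟨s, hs, hs1⟩ := exists_between ha
      obtain ⟨K, hK⟩ := eventually_bounded_of_injOn ht₀ hd hinj (fun z hz => hc z hz t₀ ht₀) hs1
      refine ⟨s - ‖a‖, by linarith, K, hK.mono fun t ht z hz _ => ht z ?_⟩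
      rw [mem_ball_iff_norm] at hz
      rw [mem_closedBall_zero_iff]
      have := norm_sub_norm_le z a
      linarith)
    (fun a ha => hc a ha t₀ ht₀)
  have hprod : 𝓝[Metric.ball 0 1 ×ˢ I] (z₀, t₀) = 𝓝[Metric.ball 0 1] z₀ ×ˢ 𝓝[I] t₀ :=
    nhdsWithin_prod_eq _ _ _ _
  have h1 : Tendsto Prod.fst (𝓝[Metric.ball 0 1 ×ˢ I] (z₀, t₀)) (𝓝[Metric.ball 0 1] z₀) := by
    rw [hprod]; exact tendsto_fst
  have h2 : Tendsto Prod.snd (𝓝[Metric.ball 0 1 ×ˢ I] (z₀, t₀)) (𝓝[I] t₀) := by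
    rw [hprod]; exact tendsto_snd
  refine tendsto_comp_of_locally_uniform_limit_within (F := fun x : ℂ × ℝ => fun z => f z x.2)
    ((hd t₀ ht₀).continuousOn z₀ hz₀) h1 fun u hu => ?_
  obtain ⟨V, hV, hV'⟩ := hlu u hu z₀ hz₀
  exact ⟨V, hV, h2.eventually hV'⟩

/-- First-order expansion at time `0`, uniform up to the boundary, of a univalent solution of the
Löwner–Kufarev equation. -/
theorem loewner_kufarev_expansion {T : ℝ} (hT : 0 < T) {p p' f fz : ℂ → ℝ → ℂ}
    (hp_cont : ∀ t ∈ Set.Ico (0:ℝ) T,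
      ContinuousOn (fun z => p z t) (Metric.closedBall (0:ℂ) 1))
    (hp_re : ∀ t ∈ Set.Ico (0:ℝ) T, ∀ z ∈ Metric.ball (0:ℂ) 1, 0 < (p z t).re)
    (hp' : ∀ t ∈ Set.Ico (0:ℝ) T, ∀ z ∈ Metric.ball (0:ℂ) 1,
      HasDerivAt (fun x => p x t) (p' z t) z)
    (hp_t : ∀ z ∈ Metric.closedBall (0:ℂ) 1, ContinuousOn (fun t => p z t) (Set.Ico 0 T))
    {M M' : ℝ}
    (hp_bdd : ∀ z ∈ Metric.closedBall (0:ℂ) 1, ∀ t ∈ Set.Ico (0:ℝ) T, ‖p z t‖ ≤ M)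
    (hp'_bdd : ∀ z ∈ Metric.closedBall (0:ℂ) 1, ∀ t ∈ Set.Ico (0:ℝ) T, ‖p' z t‖ ≤ M')
    (hf_init : ∀ z ∈ Metric.ball (0:ℂ) 1, f z 0 = z)
    (hf_hol : ∀ t ∈ Set.Ico (0:ℝ) T,
      DifferentiableOn ℂ (fun z => f z t) (Metric.ball (0:ℂ) 1))
    (hf_inj : ∀ t ∈ Set.Ico (0:ℝ) T,
      Set.InjOn (fun z => f z t) (Metric.ball (0:ℂ) 1))
    (hf_cl : ∀ t ∈ Set.Ico (0:ℝ) T,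
      ContinuousOn (fun z => f z t) (Metric.closedBall (0:ℂ) 1))
    (hfz : ∀ t ∈ Set.Ico (0:ℝ) T, ∀ z ∈ Metric.ball (0:ℂ) 1,
      HasDerivAt (fun x => f x t) (fz z t) z)
    (hf_pde : ∀ z ∈ Metric.ball (0:ℂ) 1, ∀ t ∈ Set.Ico (0:ℝ) T,
      HasDerivWithinAt (fun u => f z u) (-(z * fz z t * p z t)) (Set.Ico 0 T) t)
    {ε : ℝ} (hε : 0 < ε) :
    ∃ δ > 0, δ < T ∧ ∀ t ∈ Set.Icc 0 δ, ∀ z ∈ Metric.closedBall (0 : ℂ) 1,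
      ‖f z t - z + t * z * p z 0‖ ≤ ε * t := by
  have h0T : (0 : ℝ) ∈ Set.Ico 0 T := ⟨le_rfl, hT⟩
  have h0b : (0 : ℂ) ∈ Metric.closedBall (0 : ℂ) 1 := Metric.mem_closedBall_self zero_le_one
  have hM : 0 ≤ M := (norm_nonneg _).trans (hp_bdd 0 h0b 0 h0T)
  have hM' : 0 ≤ M' := (norm_nonneg _).trans (hp'_bdd 0 h0b 0 h0T)
  have hbc : Metric.ball (0 : ℂ) 1 ⊆ Metric.closedBall 0 1 := Metric.ball_subset_closedBall
  have hunif := eventually_uniform_of_lipschitz (K := M'.toNNReal) h0T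
    (fun t ht => lipschitzOnWith_closedBall_of_hasDerivAt (hp_cont t ht) (hp' t ht) fun z hz => by
      rw [Real.coe_toNNReal _ hM']; exact hp'_bdd z (hbc hz) t ht)
    (fun z hz => hp_t z hz 0 h0T) (half_pos hε)
  obtain ⟨η, hη, hη'⟩ := Metric.mem_nhdsWithin_iff.1 hunif
  set δ : ℝ := min (min (η / 2) (T / 2)) (ε / (2 * (M * (M + M') + 1)))
  have hC : 0 ≤ M * (M + M') := by positivity
  have hδ : 0 < δ := by positivity
  have hδη : δ < η := ((min_le_left _ _).trans (min_le_left _ _)).trans_lt (half_lt_self hη)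
  have hδT : δ < T := ((min_le_left _ _).trans (min_le_right _ _)).trans_lt (half_lt_self hT)
  have hδε : δ * (M * (M + M')) ≤ ε / 2 := by
    have h : δ ≤ ε / (2 * (M * (M + M') + 1)) := min_le_right _ _
    rw [le_div_iff₀ (by positivity)] at h
    nlinarith
  have hsubT : Set.Icc 0 δ ⊆ Set.Ico 0 T := fun t ht => ⟨ht.1, ht.2.trans_lt hδT⟩
  have hpu : ∀ t ∈ Set.Icc 0 δ, ∀ z ∈ Metric.closedBall (0 : ℂ) 1, ‖p z t - p z 0‖ ≤ ε / 2 := by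
    intro t ht z hz
    refine (hη' ⟨?_, hsubT ht⟩ z hz).le
    rw [Metric.mem_ball, Real.dist_eq, sub_zero, abs_of_nonneg ht.1]
    exact ht.2.trans_lt hδη
  have hjoint := continuousOn_uncurry_of_injOn hf_hol hf_inj
    (fun z hz t ht => (hf_pde z hz t ht).continuousWithinAt)
  have hinside : ∀ t ∈ Set.Icc 0 δ, ∀ z ∈ Metric.ball (0 : ℂ) 1,
      ‖f z t - z + t * z * p z 0‖ ≤ ε * t := by
    intro t ht z hz
    have hz1 : ‖z‖ < 1 := mem_ball_zero_iff.1 hz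
    have hsub : Metric.closedBall (0 : ℂ) ‖z‖ ⊆ Metric.ball 0 1 :=
      Metric.closedBall_subset_ball hz1
    refine norm_le_of_transport (e := fun z t => f z t - z + t * z * p z 0) (r := ‖z‖) (t₁ := δ)
      hε.le ?_ ?_ ?_ z (by simp) t ht
    · have h1 := hjoint.mono (Set.prod_mono hsub hsubT)
      have h2 : ContinuousOn (fun x : ℂ × ℝ => p x.1 0)
          (Metric.closedBall 0 ‖z‖ ×ˢ Set.Icc 0 δ) :=
        (hp_cont 0 h0T).comp continuousOn_fst fun x hx => hbc (hsub hx.1)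
      exact (h1.sub continuousOn_fst).add
        (((Complex.continuous_ofReal.comp continuous_snd).continuousOn.mul continuousOn_fst).mul h2)
    · intro x hx
      simp [hf_init x (hsub hx)]
    · intro x hx s hs
      have hx' := hsub hx
      have hxc := hbc hx'
      have hx1 : ‖x‖ ≤ 1 := mem_closedBall_zero_iff.1 hxc
      have hs' : s ∈ Set.Icc 0 δ := ⟨hs.1.le, hs.2⟩
      have hsT := hsubT hs'
      refine ⟨fz x s - 1 + s * (p x 0 + x * p' x 0), p x s,
        -(x * (p x s - p x 0)) + s * x * p x s * (p x 0 + x * p' x 0), ?_, hp_re s hsT x hx', ?_, ?_⟩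
      · have h1 := ((hasDerivAt_id' x).mul (hp' 0 h0T x hx')).const_mul (s : ℂ)
        have h2 := ((hfz s hsT x hx').sub (hasDerivAt_id' x)).add h1
        refine (h2.congr_deriv ?_).congr_of_eventuallyEq (Eventually.of_forall fun y => ?_)
        · ring
        · simp [mul_assoc]
      · have h1 : ‖x * (p x s - p x 0)‖ ≤ 1 * (ε / 2) := by
          rw [norm_mul]
          exact mul_le_mul hx1 (hpu s hs' x hxc) (norm_nonneg _) zero_le_one
        have h2 : ‖p x 0 + x * p' x 0‖ ≤ M + M' := by
          refine (norm_add_le _ _).trans (add_le_add (hp_bdd x hxc 0 h0T) ?_)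
          rw [norm_mul]
          calc ‖x‖ * ‖p' x 0‖ ≤ 1 * M' :=
                mul_le_mul hx1 (hp'_bdd x hxc 0 h0T) (norm_nonneg _) zero_le_one
            _ = M' := one_mul _
        have h3 : ‖s * x * p x s * (p x 0 + x * p' x 0)‖ ≤ δ * 1 * M * (M + M') := by
          rw [norm_mul, norm_mul, norm_mul, Complex.norm_real, Real.norm_of_nonneg hs.1.le]
          gcongr
          · exact hs.2
          · exact hp_bdd x hxc s hsT
        refine (norm_add_le _ _).trans ?_
        rw [norm_neg]
        linarith
      · have h1 := (((hf_pde x hx' s hsT).mono hsubT).sub_const x)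
        have h2 := ((((Complex.ofRealCLM.hasDerivAt (x := s)).mul_const x).mul_const
          (p x 0)).hasDerivWithinAt (s := Set.Icc 0 δ))
        refine (h1.add h2).congr_deriv ?_
        simp only [Complex.ofRealCLM_apply, Complex.ofReal_one]
        ring
  refine ⟨δ, hδ, hδT, fun t ht z hz => ?_⟩
  rw [← closure_ball (0 : ℂ) one_ne_zero] at hz
  refine le_on_closure (f := fun z => ‖f z t - z + t * z * p z 0‖) (g := fun _ => ε * t)
    (hinside t ht) ?_ continuousOn_const hz
  rw [closure_ball (0 : ℂ) one_ne_zero]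
  exact (((hf_cl t (hsubT ht)).sub continuousOn_id).add
    ((continuousOn_const.mul continuousOn_id).mul (hp_cont 0 h0T))).norm

open Real in
/-- The norm of a circle average is at most the circle average of the norm. -/
theorem norm_circleAverage_le_circleAverage_norm {g : ℂ → ℂ} {c : ℂ} {r : ℝ} :
    ‖circleAverage g c r‖ ≤ circleAverage (fun z => ‖g z‖) c r := by
  rw [circleAverage, circleAverage, norm_smul, Real.norm_of_nonneg (by positivity), smul_eq_mul]
  gcongr
  exact intervalIntegral.norm_integral_le_integral_norm two_pi_pos.le

open Real in
/-- If `k` is holomorphic with `k 0` real, the mean square of `k` on a circle is controlled by that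
of its real part. -/
theorem circleAverage_norm_sq_le_two_mul {k : ℂ → ℂ} {r : ℝ} (hr0 : 0 < r) (hr1 : r < 1)
    (hk : DifferentiableOn ℂ k (Metric.ball 0 1)) (him : (k 0).im = 0) :
    circleAverage (fun z => ‖k z‖ ^ 2) 0 r ≤ 2 * circleAverage (fun z => (k z).re ^ 2) 0 r := by
  have hsub : Metric.closedBall (0 : ℂ) r ⊆ Metric.ball 0 1 := Metric.closedBall_subset_ball hr1
  have hks : ContinuousOn k (Metric.sphere 0 r) :=
    hk.continuousOn.mono (Metric.sphere_subset_closedBall.trans hsub)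
  have hd : DiffContOnCl ℂ (fun z => k z ^ 2) (Metric.ball 0 |r|) := by
    rw [abs_of_pos hr0]
    exact (hk.pow 2).diffContOnCl_ball hsub
  have h1 := hd.circleAverage
  have hint : CircleIntegrable (fun z => k z ^ 2) 0 r := (hks.pow 2).circleIntegrable hr0.le
  have h2 := Complex.reCLM.circleAverage_comp_comm hint
  rw [h1] at h2
  have hre : CircleIntegrable (fun z => (k z).re ^ 2) 0 r :=
    ((Complex.continuous_re.comp_continuousOn hks).pow 2).circleIntegrable hr0.le
  have hnorm : CircleIntegrable (fun z => ‖k z‖ ^ 2) 0 r :=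
    (hks.norm.pow 2).circleIntegrable hr0.le
  have h3 : Complex.reCLM ∘ (fun z => k z ^ 2) =
      (fun z => (2 : ℝ) • (k z).re ^ 2) - (fun z => ‖k z‖ ^ 2) := by
    funext z
    simp only [Function.comp_apply, Complex.reCLM_apply, Pi.sub_apply, smul_eq_mul, sq (k z),
      Complex.mul_re]
    rw [Complex.sq_norm, Complex.normSq_apply]
    ring
  have hre2 : CircleIntegrable (fun z => (2 : ℝ) • (k z).re ^ 2) 0 r := hre.const_smul
  rw [h3, circleAverage_sub hre2 hnorm, circleAverage_fun_smul] at h2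
  have h4 : (0 : ℝ) ≤ Complex.reCLM (k 0 ^ 2) := by
    simp only [Complex.reCLM_apply, sq, Complex.mul_re, him]
    nlinarith [sq_nonneg (k 0).re]
  rw [smul_eq_mul] at h2
  linarith

open Real in
/-- Interior values of a holomorphic function are controlled by its mean square on a circle. -/
theorem norm_sq_le_circleAverage {k : ℂ → ℂ} {r : ℝ} {w : ℂ} (hr1 : r < 1) (hw : ‖w‖ < r)
    (hk : DifferentiableOn ℂ k (Metric.ball 0 1)) :
    ‖k w‖ ^ 2 ≤ 1 / (r - ‖w‖) * circleAverage (fun z => ‖k z‖ ^ 2) 0 r := by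
  have hr0 : 0 < r := (norm_nonneg w).trans_lt hw
  have hsub : Metric.closedBall (0 : ℂ) r ⊆ Metric.ball 0 1 := Metric.closedBall_subset_ball hr1
  have hks : ContinuousOn k (Metric.sphere 0 r) :=
    hk.continuousOn.mono (Metric.sphere_subset_closedBall.trans hsub)
  have hd : DiffContOnCl ℂ (fun z => k z ^ 2) (Metric.ball 0 |r|) := by
    rw [abs_of_pos hr0]
    exact (hk.pow 2).diffContOnCl_ball hsub
  have h1 := hd.circleAverage_smul_div (w := w) (by rwa [abs_of_pos hr0, mem_ball_zero_iff])
  have hne : ∀ z ∈ Metric.sphere (0 : ℂ) r, r - ‖w‖ ≤ ‖z - w‖ := fun z hz => by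
    rw [mem_sphere_zero_iff_norm] at hz
    rw [← hz]
    exact norm_sub_norm_le z w
  have hc1 : ContinuousOn (fun z => ((z - 0) / (z - w)) • k z ^ 2) (Metric.sphere 0 r) := by
    refine ContinuousOn.smul (ContinuousOn.div (continuousOn_id.sub continuousOn_const)
      (continuousOn_id.sub continuousOn_const) fun z hz h => ?_) (hks.pow 2)
    have := hne z hz
    rw [show z - w = 0 from h, norm_zero] at this
    linarith
  rw [← norm_pow, ← h1]
  refine norm_circleAverage_le_circleAverage_norm.trans ?_
  rw [← smul_eq_mul, ← circleAverage_fun_smul]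
  refine circleAverage_mono (hc1.norm.circleIntegrable hr0.le)
    ((hks.norm.pow 2).circleIntegrable hr0.le).const_smul fun z hz => ?_
  rw [abs_of_pos hr0] at hz
  have h2 := hne z hz
  have h3 : ‖z‖ = r := mem_sphere_zero_iff_norm.1 hz
  simp only [sub_zero, smul_eq_mul, norm_mul, norm_div, norm_pow]
  have h4 : ‖z‖ / ‖z - w‖ ≤ 1 / (r - ‖w‖) := by
    have : 0 < r - ‖w‖ := by linarith
    rw [h3]
    gcongr
  gcongr

/-- A nonvanishing holomorphic function on the unit disc has a holomorphic logarithm. -/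
theorem exists_log_of_ne_zero {G : ℂ → ℂ} {l₀ : ℂ} (hG : DifferentiableOn ℂ G (Metric.ball 0 1))
    (hne : ∀ z ∈ Metric.ball (0 : ℂ) 1, G z ≠ 0) (hl₀ : Complex.exp l₀ = G 0) :
    ∃ L : ℂ → ℂ, DifferentiableOn ℂ L (Metric.ball 0 1) ∧ L 0 = l₀ ∧
      ∀ z ∈ Metric.ball (0 : ℂ) 1, Complex.exp (L z) = G z := by
  obtain ⟨L, hL⟩ := ((hG.deriv Metric.isOpen_ball).div hG hne).isExactOn_ball
  have h0 : (0 : ℂ) ∈ Metric.ball (0 : ℂ) 1 := Metric.mem_ball_self one_pos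
  set L' : ℂ → ℂ := fun z => L z - L 0 + l₀
  have hL' : ∀ z ∈ Metric.ball (0 : ℂ) 1, HasDerivAt L' (deriv G z / G z) z := fun z hz =>
    ((hL z hz).sub_const _).add_const _
  refine ⟨L', fun z hz => (hL' z hz).differentiableAt.differentiableWithinAt, by simp [L'], ?_⟩
  have hder : ∀ z ∈ Metric.ball (0 : ℂ) 1,
      HasDerivAt (fun z => G z * Complex.exp (-L' z)) 0 z := fun z hz => by
    have h1 := (hG.differentiableAt (Metric.isOpen_ball.mem_nhds hz)).hasDerivAt
    refine (h1.mul (hL' z hz).neg.cexp).congr_deriv ?_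
    have := hne z hz
    field_simp
    simp
  intro z hz
  have hconst := Metric.isOpen_ball.is_const_of_deriv_eq_zero (convex_ball (0 : ℂ) 1).isPreconnected
    (fun z hz => (hder z hz).differentiableAt.differentiableWithinAt)
    (fun z hz => (hder z hz).deriv) hz h0
  have h2 : L' 0 = l₀ := by simp [L']
  simp only [h2, ← hl₀, ← Complex.exp_add, add_neg_cancel, Complex.exp_zero] at hconst
  rw [Complex.exp_neg, mul_inv_eq_one₀ (Complex.exp_ne_zero _)] at hconst
  exact hconst.symm

/-- The real logarithm of the modulus of a number close to `ζ - tζa`, `‖ζ‖ = 1`, to first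
order in `t`. -/
theorem abs_log_norm_add_le {M ε t : ℝ} {ζ a u g : ℂ} (hM : 1 ≤ M) (hε1 : ε ≤ 1)
    (ht : 0 < t) (htM : 8 * t * M ^ 2 ≤ ε) (hζ : ‖ζ‖ = 1) (ha : ‖a‖ ≤ M)
    (hu : ‖u - ζ + t * ζ * a‖ ≤ ε * t) (hg : |‖g‖ - ‖u‖| ≤ ε * t) :
    |Real.log ‖g‖ + t * a.re| ≤ 7 * ε * t ∧ |Real.log ‖g‖| ≤ 8 * t * M := by
  have hM2 : M ≤ M ^ 2 := by nlinarith
  have hM0 : 0 < M := by linarith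
  have htMM : t * M ≤ t * M ^ 2 := mul_le_mul_of_nonneg_left hM2 ht.le
  have htM0 : 0 < t * M := mul_pos ht hM0
  have hε : 0 < ε := by linarith
  set y := ‖1 - t * a‖
  have hy : |‖u‖ - y| ≤ ε * t := by
    have h1 : ‖ζ * (1 - t * a)‖ = y := by rw [norm_mul, hζ, one_mul]
    rw [← h1]
    refine (abs_norm_sub_norm_le _ _).trans (le_trans (le_of_eq ?_) hu)
    ring_nf
  have hre : |a.re| ≤ M := (Complex.abs_re_le_norm a).trans ha
  have htMs : 8 * (t * M) ≤ ε := by linarith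
  have hta : |t * a.re| ≤ t * M := by rw [abs_mul, abs_of_pos ht]; gcongr
  have hysq : y ^ 2 = 1 - 2 * (t * a.re) + t ^ 2 * ‖a‖ ^ 2 := by
    simp only [y, Complex.sq_norm, Complex.normSq_apply, Complex.sub_re, Complex.sub_im,
      Complex.mul_re, Complex.mul_im, Complex.ofReal_re, Complex.ofReal_im, Complex.one_re,
      Complex.one_im]
    ring
  have hsqle : (t * a.re) ^ 2 ≤ t ^ 2 * ‖a‖ ^ 2 := by
    rw [mul_pow]
    have := sq_le_sq' (by linarith [neg_abs_le a.re, Complex.abs_re_le_norm a])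
      ((le_abs_self _).trans (Complex.abs_re_le_norm a))
    gcongr
  have htm2 : t ^ 2 * ‖a‖ ^ 2 ≤ ε * t / 8 := by
    calc t ^ 2 * ‖a‖ ^ 2 ≤ t ^ 2 * M ^ 2 := by gcongr
      _ = t * (8 * t * M ^ 2) / 8 := by ring
      _ ≤ t * ε / 8 := by gcongr
      _ = ε * t / 8 := by ring
  have ⟨hta1, hta2⟩ := abs_le.1 hta
  have hy0 : 0 ≤ y := norm_nonneg _
  have hylow : 1 - t * a.re ≤ y := by
    refine le_of_pow_le_pow_left₀ two_ne_zero hy0 ?_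
    linarith [show (1 - t * a.re) ^ 2 = 1 - 2 * (t * a.re) + (t * a.re) ^ 2 by ring]
  have hyup : y ≤ 1 - t * a.re + t ^ 2 * ‖a‖ ^ 2 := by
    have hnn : 0 ≤ t ^ 2 * ‖a‖ ^ 2 := by positivity
    refine le_of_pow_le_pow_left₀ two_ne_zero (by linarith) ?_
    have h1 : 0 ≤ (t * a.re - t ^ 2 * ‖a‖ ^ 2) ^ 2 := sq_nonneg _
    have h2 : 0 ≤ t ^ 2 * ‖a‖ ^ 2 := hnn
    linarith [show (1 - t * a.re + t ^ 2 * ‖a‖ ^ 2) ^ 2 = 1 - 2 * (t * a.re) +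
      2 * (t ^ 2 * ‖a‖ ^ 2) + (t * a.re - t ^ 2 * ‖a‖ ^ 2) ^ 2 by ring]
  have hεt : ε * t ≤ t * M := by
    rw [mul_comm]
    exact mul_le_mul_of_nonneg_left (by linarith) ht.le
  set x := ‖g‖
  have ⟨hg1, hg2⟩ := abs_le.1 hg
  have ⟨hy1, hy2⟩ := abs_le.1 hy
  have hεt0 : 0 < ε * t := by positivity
  have hx1 : |x - (1 - t * a.re)| ≤ 3 * (ε * t) := abs_le.2 ⟨by linarith, by linarith⟩
  have ⟨hx1a, hx1b⟩ := abs_le.1 hx1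
  have hx2 : |x - 1| ≤ 4 * (t * M) := abs_le.2 ⟨by linarith, by linarith⟩
  have ⟨hx2a, hx2b⟩ := abs_le.1 hx2
  have hxh : 1 / 2 ≤ x := by linarith
  have hx0 : 0 < x := by linarith
  have hsq : (x - 1) ^ 2 ≤ 16 * (t * M) ^ 2 := by
    linarith [sq_le_sq' hx2a hx2b, show (4 * (t * M)) ^ 2 = 16 * (t * M) ^ 2 by ring]
  have htM2 : (t * M) ^ 2 ≤ ε * t / 8 := by
    calc (t * M) ^ 2 = t * (8 * t * M ^ 2) / 8 := by ring
      _ ≤ t * ε / 8 := by gcongr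
      _ = ε * t / 8 := by ring
  have hl1 := Real.log_le_sub_one_of_pos hx0
  have hl2 : x - 1 - 2 * (x - 1) ^ 2 ≤ Real.log x := by
    refine le_trans ?_ (Real.one_sub_inv_le_log_of_pos hx0)
    have : x⁻¹ * x = 1 := inv_mul_cancel₀ hx0.ne'
    have hi : x⁻¹ ≤ 2 := by
      rw [inv_le_comm₀ hx0 two_pos]; linarith
    have e : 1 - x⁻¹ - (x - 1) = -(x⁻¹ * (x - 1) ^ 2) := by
      linear_combination (x - 2) * this
    linarith [mul_le_mul_of_nonneg_right hi (sq_nonneg (x - 1))]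
  have key : |Real.log x + t * a.re| ≤ 7 * ε * t := abs_le.2 ⟨by linarith, by linarith⟩
  refine ⟨key, ?_⟩
  have ⟨k1, k2⟩ := abs_le.1 key
  exact abs_le.2 ⟨by linarith, by linarith⟩

/-- `exp` is Lipschitz at `0` on the half-plane `re ≤ 1`. -/
theorem norm_exp_sub_one_le_four_mul {L : ℂ} (hL : L.re ≤ 1) :
    ‖Complex.exp L - 1‖ ≤ 4 * ‖L‖ := by
  by_cases h : ‖L‖ ≤ 1
  · have := Complex.norm_exp_sub_one_le h
    linarith [norm_nonneg L]
  · refine (norm_sub_le _ _).trans ?_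
    rw [Complex.norm_exp, norm_one]
    have h1 : Real.exp L.re ≤ Real.exp 1 := Real.exp_le_exp.2 hL
    have h2 := Real.exp_one_lt_d9
    push Not at h
    norm_num at h2
    linarith

open ComplexConjugate in
/-- Pointwise estimates near the unit circle for the logarithm `L` of a map whose boundary values
are, up to a rotation by `ω`, those of `ζ ↦ ζ - tζp(ζ)`. -/
theorem abs_re_log_le_of_near_circle {p : ℂ → ℂ} {M M' ε t r : ℝ} {ω ζ w L u : ℂ}
    (hM : 1 ≤ M) (hM' : 1 ≤ M') (hε1 : ε ≤ 1) (ht : 0 < t) (htM : 8 * t * M ^ 2 ≤ ε)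
    (hp : ∀ z ∈ Metric.closedBall (0 : ℂ) 1, ‖p z‖ ≤ M)
    (hpL : ∀ z ∈ Metric.closedBall (0 : ℂ) 1, ∀ z' ∈ Metric.closedBall (0 : ℂ) 1,
      ‖p z - p z'‖ ≤ M' * ‖z - z'‖)
    (hr0 : 0 < r) (hr1 : r < 1) (hrε : 1 - r ≤ ε) (hω : ‖ω‖ = 1) (hw : w = r * ω) (hζ : ‖ζ‖ = 1)
    (hu : ‖conj ω * u - ζ + t * ζ * p ζ‖ ≤ ε * t) (hL : ‖u - Complex.exp L‖ ≤ ε * t) :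
    L.re ^ 2 ≤ ε ^ 2 ∧
      (L / t + conj (p (conj w))).re ^ 2 ≤ M' ^ 2 * (162 * ε ^ 2 + 32 * ‖L‖ ^ 2) := by
  have hM2 : M ≤ M ^ 2 := by nlinarith
  have htMM : t * M ≤ t * M ^ 2 := mul_le_mul_of_nonneg_left hM2 ht.le
  have htM0 : t ≤ t * M := le_mul_of_one_le_right ht.le hM
  have hε0 : 0 ≤ ε := by linarith
  have hωc : ‖conj ω‖ = 1 := by rw [Complex.norm_conj, hω]
  have hζb : ζ ∈ Metric.closedBall (0 : ℂ) 1 := by simp [hζ]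
  have hwb : conj w ∈ Metric.closedBall (0 : ℂ) 1 := by
    rw [mem_closedBall_zero_iff, Complex.norm_conj, hw, norm_mul, hω, Complex.norm_real,
      Real.norm_of_nonneg hr0.le]
    linarith
  have hun : ‖conj ω * u‖ = ‖u‖ := by rw [norm_mul, hωc, one_mul]
  obtain ⟨h1, h2⟩ := abs_log_norm_add_le (g := Complex.exp L) hM hε1 ht htM hζ (hp ζ hζb) hu (by
    rw [hun, abs_sub_comm]
    exact (abs_norm_sub_norm_le _ _).trans hL)
  rw [Complex.norm_exp, Real.log_exp] at h1 h2
  have hLε : |L.re| ≤ ε := by linarith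
  refine ⟨sq_le_sq' (abs_le.1 hLε).1 (abs_le.1 hLε).2, ?_⟩
  have hεt : ε * t ≤ t := mul_le_of_le_one_left ht.le hε1
  have hdist : ‖ζ - conj w‖ ≤ 2 * ε + 4 * ‖L‖ := by
    have e : ζ - conj w = -(conj ω * u - ζ + t * ζ * p ζ) + t * ζ * p ζ +
        conj ω * (u - Complex.exp L) + conj ω * (Complex.exp L - 1) + ((1 - r : ℝ) : ℂ) * conj ω := by
      rw [hw, map_mul, Complex.conj_ofReal]
      push_cast
      ring
    have a1 : ‖(t : ℂ) * ζ * p ζ‖ ≤ t * M := by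
      rw [norm_mul, norm_mul, hζ, mul_one, Complex.norm_real, Real.norm_of_nonneg ht.le]
      exact mul_le_mul_of_nonneg_left (hp ζ hζb) ht.le
    have a2 : ‖conj ω * (u - Complex.exp L)‖ ≤ ε * t := by rwa [norm_mul, hωc, one_mul]
    have a3 : ‖conj ω * (Complex.exp L - 1)‖ ≤ 4 * ‖L‖ := by
      rw [norm_mul, hωc, one_mul]
      exact norm_exp_sub_one_le_four_mul (by linarith [(abs_le.1 hLε).2])
    have a4 : ‖((1 - r : ℝ) : ℂ) * conj ω‖ ≤ ε := by
      rwa [norm_mul, hωc, mul_one, Complex.norm_real, Real.norm_of_nonneg (by linarith)]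
    rw [e]
    refine (norm_add_le_of_le (norm_add_le_of_le (norm_add_le_of_le (norm_add_le_of_le
      ((norm_neg _).trans_le hu) a1) a2) a3) a4).trans ?_
    linarith
  have hre : (L / t + conj (p (conj w))).re = (L.re + t * (p ζ).re) / t + (p (conj w) - p ζ).re := by
    rw [Complex.add_re, Complex.div_ofReal_re, Complex.conj_re, Complex.sub_re]
    field_simp
    ring
  have hb1 : |(L.re + t * (p ζ).re) / t| ≤ 7 * ε := by
    rw [abs_div, abs_of_pos ht, div_le_iff₀ ht]
    exact h1
  have hb2 : |(p (conj w) - p ζ).re| ≤ M' * (2 * ε + 4 * ‖L‖) := by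
    refine (Complex.abs_re_le_norm _).trans ((hpL _ hwb _ hζb).trans ?_)
    rw [norm_sub_rev]
    gcongr
  have hb : |(L / t + conj (p (conj w))).re| ≤ M' * (9 * ε + 4 * ‖L‖) := by
    rw [hre]
    refine (abs_add_le _ _).trans ((add_le_add hb1 hb2).trans ?_)
    nlinarith
  calc (L / t + conj (p (conj w))).re ^ 2 ≤ (M' * (9 * ε + 4 * ‖L‖)) ^ 2 :=
        sq_le_sq' (abs_le.1 hb).1 (abs_le.1 hb).2
    _ = M' ^ 2 * (9 * ε + 4 * ‖L‖) ^ 2 := by ring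
    _ ≤ M' ^ 2 * (162 * ε ^ 2 + 32 * ‖L‖ ^ 2) := by
        gcongr
        nlinarith [sq_nonneg (9 * ε - 4 * ‖L‖)]

open ComplexConjugate Real in
/-- Let `G` be the inversion of an exterior map whose boundary curve is the image of the unit
circle under `ζ ↦ ζ - tζp(ζ)` up to an error `εt`. Then `log G / t` is close to `-conj (p (conj w))`
inside the disc. -/
theorem exists_log_norm_sq_le {p G : ℂ → ℂ} {M M' ε t s : ℝ}
    (hM : 1 ≤ M) (hM' : 1 ≤ M') (hε0 : 0 < ε) (hε1 : ε ≤ 1) (ht : 0 < t) (htM : 8 * t * M ^ 2 ≤ ε)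
    (hpd : DifferentiableOn ℂ p (Metric.ball 0 1))
    (hp : ∀ z ∈ Metric.closedBall (0 : ℂ) 1, ‖p z‖ ≤ M)
    (hpL : ∀ z ∈ Metric.closedBall (0 : ℂ) 1, ∀ z' ∈ Metric.closedBall (0 : ℂ) 1,
      ‖p z - p z'‖ ≤ M' * ‖z - z'‖)
    (hp0 : p 0 = 1) (hGc : ContinuousOn G (Metric.closedBall 0 1))
    (hGd : DifferentiableOn ℂ G (Metric.ball 0 1))
    (hne : ∀ z ∈ Metric.ball (0 : ℂ) 1, G z ≠ 0) (hG0 : Complex.exp (-s) = G 0)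
    (hcirc : ∀ ω ∈ Metric.sphere (0 : ℂ) 1, ∃ ζ ∈ Metric.sphere (0 : ℂ) 1,
      ‖conj ω * G ω - ζ + t * ζ * p ζ‖ ≤ ε * t)
    {w₀ : ℂ} (hw₀ : w₀ ∈ Metric.ball (0 : ℂ) 1) :
    ∃ l : ℂ, Complex.exp l = G w₀ ∧
      ‖l / t + conj (p (conj w₀))‖ ^ 2 ≤ 2 / (1 - ‖w₀‖) * (452 * M' ^ 2 * ε ^ 2) := by
  obtain ⟨L, hLd, hL0, hLexp⟩ := exists_log_of_ne_zero hGd hne hG0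
  refine ⟨L w₀, hLexp w₀ hw₀, ?_⟩
  have hw₀1 : ‖w₀‖ < 1 := mem_ball_zero_iff.1 hw₀
  set k : ℂ → ℂ := fun w => L w / t + conj (p (conj w))
  have hkd : DifferentiableOn ℂ k (Metric.ball 0 1) := by
    refine (hLd.div_const _).add fun w hw => ?_
    have hw' : conj w ∈ Metric.ball (0 : ℂ) 1 := by simpa using hw
    have h1 := (hpd.differentiableAt (Metric.isOpen_ball.mem_nhds hw')).conj_conj
    rw [Complex.conj_conj] at h1
    exact h1.differentiableWithinAt
  obtain ⟨η, hη, hηG⟩ := Metric.uniformContinuousOn_iff.1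
    ((isCompact_closedBall (0 : ℂ) 1).uniformContinuousOn_of_continuous hGc) (ε * t)
    (by positivity)
  set d := min (min ((1 - ‖w₀‖) / 2) ε) (η / 2)
  have hd : 0 < d := by
    have : 0 < 1 - ‖w₀‖ := by linarith
    positivity
  have hd1 : d ≤ (1 - ‖w₀‖) / 2 := (min_le_left _ _).trans (min_le_left _ _)
  have hd2 : d ≤ ε := (min_le_left _ _).trans (min_le_right _ _)
  have hd3 : d ≤ η / 2 := min_le_right _ _
  have hw₀0 := norm_nonneg w₀
  set r := 1 - d
  have hr0 : 0 < r := by simp only [r]; linarith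
  have hr1 : r < 1 := by simp only [r]; linarith
  have hrw : (1 - ‖w₀‖) / 2 ≤ r - ‖w₀‖ := by simp only [r]; linarith
  have hpt : ∀ w ∈ Metric.sphere (0 : ℂ) |r|, (L w).re ^ 2 ≤ ε ^ 2 ∧
      (k w).re ^ 2 ≤ M' ^ 2 * (162 * ε ^ 2 + 32 * ‖L w‖ ^ 2) := fun w hw => by
    rw [abs_of_pos hr0, mem_sphere_zero_iff_norm] at hw
    have hrne : (r : ℂ) ≠ 0 := Complex.ofReal_ne_zero.2 hr0.ne'
    have hω : ‖w / r‖ = 1 := by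
      rw [norm_div, hw, Complex.norm_real, Real.norm_of_nonneg hr0.le, div_self hr0.ne']
    have hwω : w = r * (w / r) := by field_simp
    obtain ⟨ζ, hζ, hζe⟩ := hcirc (w / r) (by rwa [mem_sphere_zero_iff_norm])
    refine abs_re_log_le_of_near_circle hM hM' hε1 ht htM hp hpL hr0 hr1 (by simpa [r] using hd2)
      hω hwω (mem_sphere_zero_iff_norm.1 hζ) hζe ?_
    rw [hLexp w (by rw [mem_ball_zero_iff, hw]; exact hr1), ← dist_eq_norm]
    refine (hηG _ (by rw [mem_closedBall_zero_iff, hω]) _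
      (by rw [mem_closedBall_zero_iff, hw]; exact hr1.le) ?_).le
    have e : w / r - w = ((1 - r : ℝ) : ℂ) * (w / r) := by
      push_cast
      field_simp
    rw [dist_eq_norm, e, norm_mul, hω, mul_one, Complex.norm_real, Real.norm_of_nonneg (by linarith)]
    simp only [r]
    linarith
  have hsub : Metric.sphere (0 : ℂ) r ⊆ Metric.ball 0 1 :=
    Metric.sphere_subset_closedBall.trans (Metric.closedBall_subset_ball hr1)
  have hLs := hLd.continuousOn.mono hsub
  have hks := hkd.continuousOn.mono hsub
  have hcL : CircleIntegrable (fun z => ‖L z‖ ^ 2) 0 r := (hLs.norm.pow 2).circleIntegrable hr0.le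
  have hcL32 : CircleIntegrable (fun z => (32 : ℝ) • ‖L z‖ ^ 2) 0 r := hcL.const_smul
  have hLre : circleAverage (fun z => (L z).re ^ 2) 0 r ≤ ε ^ 2 :=
    circleAverage_mono_on_of_le_circle
      (((Complex.continuous_re.comp_continuousOn hLs).pow 2).circleIntegrable hr0.le)
      fun w hw => (hpt w hw).1
  have hLavg := circleAverage_norm_sq_le_two_mul hr0 hr1 hLd (by rw [hL0]; simp)
  have hkre : circleAverage (fun z => (k z).re ^ 2) 0 r ≤ M' ^ 2 * (226 * ε ^ 2) := by
    have hmono := circleAverage_mono (c := 0) (R := r)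
      (f₁ := fun z => (k z).re ^ 2) (f₂ := fun z => M' ^ 2 * (162 * ε ^ 2 + 32 * ‖L z‖ ^ 2))
      (((Complex.continuous_re.comp_continuousOn hks).pow 2).circleIntegrable hr0.le)
      ((continuousOn_const.mul (continuousOn_const.add
        (continuousOn_const.mul (hLs.norm.pow 2)))).circleIntegrable hr0.le)
      fun w hw => (hpt w hw).2
    refine hmono.trans ?_
    simp only [← smul_eq_mul (a := M' ^ 2), ← smul_eq_mul (a := (32 : ℝ))]
    rw [circleAverage_fun_smul, circleAverage_fun_add (circleIntegrable_const _ _ _)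
      hcL32, circleAverage_fun_smul, circleAverage_const]
    simp only [smul_eq_mul]
    gcongr
    linarith
  have hkavg := circleAverage_norm_sq_le_two_mul hr0 hr1 hkd (by
    simp [k, hL0, hp0, Complex.div_ofReal_im])
  have hpoint := norm_sq_le_circleAverage hr1 (show ‖w₀‖ < r by linarith) hkd
  have hB : circleAverage (fun z => ‖k z‖ ^ 2) 0 r ≤ 452 * M' ^ 2 * ε ^ 2 := by linarith
  refine hpoint.trans ?_
  have h1 : 1 / (r - ‖w₀‖) ≤ 2 / (1 - ‖w₀‖) := by
    rw [div_le_div_iff₀ (by linarith) (by linarith)]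
    linarith
  have : 0 < r - ‖w₀‖ := by linarith
  calc 1 / (r - ‖w₀‖) * circleAverage (fun z => ‖k z‖ ^ 2) 0 r
      ≤ 1 / (r - ‖w₀‖) * (452 * M' ^ 2 * ε ^ 2) := by gcongr
    _ ≤ 2 / (1 - ‖w₀‖) * (452 * M' ^ 2 * ε ^ 2) := by gcongr

/-- The function `w ↦ w * F w⁻¹`, for `F` with a simple pole at `∞`, extends to the unit disc. -/
theorem inversion_regular {F : ℂ → ℂ} {c b : ℂ} (hd : DifferentiableOn ℂ F {z : ℂ | 1 < ‖z‖})
    (hc : ContinuousOn F {z : ℂ | 1 ≤ ‖z‖})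
    (hexp : Tendsto (fun z : ℂ => F z - c * z) (Bornology.cobounded ℂ) (𝓝 b)) :
    ContinuousOn (Function.update (fun w => w * F w⁻¹) 0 c) (Metric.closedBall 0 1) ∧
      DifferentiableOn ℂ (Function.update (fun w => w * F w⁻¹) 0 c) (Metric.ball 0 1) := by
  set G := Function.update (fun w => w * F w⁻¹) 0 c
  have hG0 : ContinuousAt G 0 := by
    refine continuousAt_update_same.2 ?_
    have h1 := hexp.comp (tendsto_inv₀_nhdsNE_zero (α := ℂ))
    have h2 : Tendsto (fun w : ℂ => w) (𝓝[≠] 0) (𝓝 0) := tendsto_id.mono_left nhdsWithin_le_nhds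
    have h3 := (h2.mul h1).add_const c
    rw [zero_mul, zero_add] at h3
    refine h3.congr' ?_
    filter_upwards [self_mem_nhdsWithin] with w hw
    have hw' : w ≠ 0 := hw
    simp only [Function.comp_apply]
    field_simp
    ring
  have hGne : ∀ w : ℂ, w ≠ 0 → G w = w * F w⁻¹ := fun w hw => Function.update_of_ne hw _ _
  constructor
  · intro w hw
    by_cases h0 : w = 0
    · rw [h0]
      exact hG0.continuousWithinAt
    · have h1 : ContinuousOn (fun w => w * F w⁻¹) (Metric.closedBall 0 1 ∩ {0}ᶜ) := by
        refine continuousOn_id.mul (hc.comp (continuousOn_inv₀.mono Set.inter_subset_right) ?_)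
        intro x hx
        rw [Set.mem_ofPred_eq, norm_inv]
        exact (one_le_inv₀ (norm_pos_iff.2 hx.2)).2 (mem_closedBall_zero_iff.1 hx.1)
      have h2 : ContinuousOn G (Metric.closedBall 0 1 ∩ {0}ᶜ) := h1.congr fun x hx => hGne x hx.2
      exact (h2 w ⟨hw, h0⟩).mono_of_mem_nhdsWithin
        (inter_mem_nhdsWithin _ (isOpen_compl_singleton.mem_nhds h0))
  · refine (Complex.differentiableOn_compl_singleton_and_continuousAt_iff
      (Metric.ball_mem_nhds 0 one_pos)).1 ⟨?_, hG0⟩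
    have h1 : DifferentiableOn ℂ (fun w => w * F w⁻¹) (Metric.ball 0 1 \ {0}) := by
      refine differentiableOn_id.mul (hd.comp (fun x hx =>
        (differentiableAt_inv hx.2).differentiableWithinAt) ?_)
      intro x hx
      rw [Set.mem_ofPred_eq, norm_inv]
      exact (one_lt_inv₀ (norm_pos_iff.2 hx.2)).2 (mem_ball_zero_iff.1 hx.1)
    exact h1.congr fun x hx => hGne x hx.2

/-- A holomorphic function on the disc, unimodular on the circle and equal to `1` at the origin,
is identically `1`. -/
theorem eqOn_one_of_norm_eq_one {G : ℂ → ℂ} (hc : ContinuousOn G (Metric.closedBall 0 1))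
    (hd : DifferentiableOn ℂ G (Metric.ball 0 1)) (h1 : ∀ z ∈ Metric.sphere (0 : ℂ) 1, ‖G z‖ = 1)
    (h0 : G 0 = 1) : ∀ z ∈ Metric.ball (0 : ℂ) 1, G z = 1 := by
  have hdc : DiffContOnCl ℂ G (Metric.ball 0 1) :=
    ⟨hd, by rwa [closure_ball (0 : ℂ) one_ne_zero]⟩
  have h0b : (0 : ℂ) ∈ Metric.ball (0 : ℂ) 1 := Metric.mem_ball_self one_pos
  have hmax : IsMaxOn (norm ∘ G) (Metric.ball 0 1) 0 := fun z hz => by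
    simp only [Set.mem_ofPred_eq, Function.comp_apply, h0, norm_one]
    refine Complex.norm_le_of_forall_mem_frontier_norm_le Metric.isBounded_ball hdc
      (fun w hw => ?_) (subset_closure hz)
    rw [frontier_ball (0 : ℂ) one_ne_zero] at hw
    exact (h1 w hw).le
  intro z hz
  have := Complex.eqOn_of_isPreconnected_of_isMaxOn_norm (convex_ball (0 : ℂ) 1).isPreconnected
    Metric.isOpen_ball hd h0b hmax hz
  rw [this, Function.const_apply, h0]

/-- The image of the disc under a univalent map continuous up to the boundary does not meet an
unbounded component of the complement of the boundary curve. -/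
theorem image_notMem_connectedComponentIn_of_not_isBounded {g : ℂ → ℂ}
    (hd : DifferentiableOn ℂ g (Metric.ball 0 1)) (hc : ContinuousOn g (Metric.closedBall 0 1))
    (hinj : Set.InjOn g (Metric.ball 0 1)) {x : ℂ}
    (hx : ¬ Bornology.IsBounded (connectedComponentIn (g '' Metric.sphere (0 : ℂ) 1)ᶜ x))
    {y : ℂ} (hy : y ∈ Metric.ball (0 : ℂ) 1) :
    g y ∉ connectedComponentIn (g '' Metric.sphere (0 : ℂ) 1)ᶜ x := by
  intro hmem
  have hbc : Metric.ball (0 : ℂ) 1 ⊆ Metric.closedBall 0 1 := Metric.ball_subset_closedBall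
  have hcpt : IsCompact (g '' Metric.closedBall 0 1) :=
    (isCompact_closedBall (0 : ℂ) 1).image_of_continuousOn hc
  have hopen : IsOpen (g '' Metric.ball 0 1) := by
    rcases (hd.analyticOnNhd Metric.isOpen_ball).is_constant_or_isOpen
      (convex_ball (0 : ℂ) 1).isPreconnected with ⟨w, hw⟩ | h
    · exfalso
      have h0 : (0 : ℂ) ∈ Metric.ball (0 : ℂ) 1 := Metric.mem_ball_self one_pos
      have h2 : (1 / 2 : ℂ) ∈ Metric.ball (0 : ℂ) 1 := by
        rw [mem_ball_zero_iff]
        norm_num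
      have := hinj h0 h2 ((hw 0 h0).trans (hw _ h2).symm)
      norm_num at this
    · exact h _ subset_rfl Metric.isOpen_ball
  have hcl : closure (g '' Metric.ball 0 1) ⊆ g '' Metric.closedBall 0 1 :=
    closure_minimal (Set.image_mono hbc) hcpt.isClosed
  refine hx ((hcpt.isBounded.subset (Set.image_mono hbc)).subset ?_)
  refine isPreconnected_connectedComponentIn.subset_left_of_subset_union hopen
    isClosed_closure.isOpen_compl
    (Set.disjoint_compl_right_iff_subset.2 subset_closure) (fun z hz => ?_)
    ⟨g y, hmem, Set.mem_image_of_mem g hy⟩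
  have hzs := connectedComponentIn_subset _ _ hz
  by_contra! hcon
  rw [Set.mem_union, not_or, Set.notMem_compl_iff] at hcon
  obtain ⟨v, hv, rfl⟩ := hcl hcon.2
  rw [← Metric.ball_union_sphere] at hv
  rcases hv with hv | hv
  · exact hcon.1 (Set.mem_image_of_mem g hv)
  · exact hzs (Set.mem_image_of_mem g hv)

/-- If `g t` has logarithms `l` with `l / t → -P`, then `(g t - 1) / t → -P`. -/
theorem tendsto_slope_of_log {g : ℝ → ℂ} {P : ℂ} {C : ℝ} (hC : 0 ≤ C)
    (h : ∀ ε : ℝ, 0 < ε → ε ≤ 1 → ∀ᶠ t in 𝓝[>] (0 : ℝ), ∃ l : ℂ, Complex.exp l = g t ∧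
      ‖l / t + P‖ ^ 2 ≤ C * ε ^ 2) :
    Tendsto (fun t : ℝ => (g t - 1) / t) (𝓝[>] 0) (𝓝 (-P)) := by
  rw [Metric.tendsto_nhds]
  intro η hη
  set ε := min 1 (η / (4 * (C + 1)))
  have hε : 0 < ε := by positivity
  have hε2 : (C + 1) * ε ≤ η / 4 := by
    calc (C + 1) * ε ≤ (C + 1) * (η / (4 * (C + 1))) := by gcongr; exact min_le_right _ _
      _ = η / 4 := by field_simp
  set B := ‖P‖ + η
  have hB : 0 < B := by positivity
  have hsmall : ∀ᶠ t in 𝓝[>] (0 : ℝ), t < min (1 / B) (η / (2 * B ^ 2)) :=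
    nhdsWithin_le_nhds (Iio_mem_nhds (by positivity))
  filter_upwards [h ε hε (min_le_left _ _), hsmall, self_mem_nhdsWithin] with t ⟨l, hl, hlP⟩ hts ht
  have ht0 : 0 < t := ht
  have htc : (t : ℂ) ≠ 0 := Complex.ofReal_ne_zero.2 ht0.ne'
  have h1 : ‖l / t + P‖ ≤ η / 4 := by
    refine le_trans (le_of_pow_le_pow_left₀ two_ne_zero (by positivity) ?_) hε2
    refine hlP.trans ?_
    rw [mul_pow]
    gcongr
    nlinarith
  have hlt : ‖l‖ ≤ t * B := by
    have e : l = t * ((l / t + P) - P) := by field_simp; ring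
    rw [e, norm_mul, Complex.norm_real, Real.norm_of_nonneg ht0.le]
    gcongr
    refine (norm_sub_le _ _).trans ?_
    simp only [B]
    linarith
  have ht1 : t * B ≤ 1 := ((lt_div_iff₀ hB).1 (hts.trans_le (min_le_left _ _))).le
  have ht2 : t * (2 * B ^ 2) < η := (lt_div_iff₀ (by positivity)).1 (hts.trans_le (min_le_right _ _))
  have h2 := Complex.norm_exp_sub_one_sub_id_le (hlt.trans ht1)
  have h3 : ‖(Complex.exp l - 1 - l) / t‖ ≤ t * B ^ 2 := by
    rw [norm_div, Complex.norm_real, Real.norm_of_nonneg ht0.le, div_le_iff₀ ht0]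
    calc _ ≤ ‖l‖ ^ 2 := h2
      _ ≤ (t * B) ^ 2 := by gcongr
      _ = t * B ^ 2 * t := by ring
  rw [dist_eq_norm, ← hl]
  have e : (Complex.exp l - 1) / t - -P = (l / t + P) + (Complex.exp l - 1 - l) / t := by
    field_simp
    ring
  rw [e]
  refine (norm_add_le _ _).trans_lt ?_
  linarith

/-- A Löwner–Kufarev evolution fixes the origin. -/
theorem loewner_kufarev_apply_zero {T : ℝ} {p f fz : ℂ → ℝ → ℂ} (h0 : f 0 0 = 0)
    (hf_pde : ∀ z ∈ Metric.ball (0 : ℂ) 1, ∀ t ∈ Set.Ico (0 : ℝ) T,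
      HasDerivWithinAt (fun u => f z u) (-(z * fz z t * p z t)) (Set.Ico 0 T) t)
    {t : ℝ} (ht : t ∈ Set.Ico 0 T) : f 0 t = 0 := by
  have hsub : Set.Icc 0 t ⊆ Set.Ico 0 T := Set.Icc_subset_Ico_right ht.2
  have hder : ∀ s ∈ Set.Ico (0 : ℝ) T, HasDerivWithinAt (fun u => f 0 u) 0 (Set.Ico 0 T) s :=
    fun s hs => by simpa using hf_pde 0 (Metric.mem_ball_self one_pos) s hs
  refine (constant_of_has_deriv_right_zero
    (fun s hs => ((hder s (hsub hs)).mono hsub).continuousWithinAt) (fun s hs => ?_) t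
    ⟨ht.1, le_rfl⟩).trans h0
  have hsT := hsub (Set.Ico_subset_Icc_self hs)
  refine ((hder s hsT).mono (Set.Ico_subset_Ico_left hs.1)).mono_of_mem_nhdsWithin ?_
  exact Ico_mem_nhdsGE hsT.2

/- STATEMENT 18: In the welding setting of Theorem 1, the interior and
exterior driving functions are related at t = 0 by
`q(ζ,0) = conj(p(1/conj(ζ),0))` for |ζ| > 1; equivalently, with
`p*(z,t) = conj(p(conj(z),t))`, one has `p*(z,0) = q(1/z,0)` for z ∈ 𝔻. -/
theorem loewner_kufarev_welding_driving_functions_relation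
    (T : ℝ) (hT : 0 < T) (p p' p'' : ℂ → ℝ → ℂ)
    -- Carathéodory class driving function, C² on 𝔻̄, continuous in t,
    -- with p, p', p'' bounded on 𝔻̄ × [0,T)
    (hp_hol : ∀ t ∈ Set.Ico (0:ℝ) T,
      DifferentiableOn ℂ (fun z => p z t) (Metric.ball (0:ℂ) 1))
    (hp_cont : ∀ t ∈ Set.Ico (0:ℝ) T,
      ContinuousOn (fun z => p z t) (Metric.closedBall (0:ℂ) 1))
    (hp_one : ∀ t ∈ Set.Ico (0:ℝ) T, p 0 t = 1)
    (hp_re : ∀ t ∈ Set.Ico (0:ℝ) T, ∀ z ∈ Metric.ball (0:ℂ) 1, 0 < (p z t).re)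
    (hp' : ∀ t ∈ Set.Ico (0:ℝ) T, ∀ z ∈ Metric.ball (0:ℂ) 1,
      HasDerivAt (fun x => p x t) (p' z t) z)
    (hp'' : ∀ t ∈ Set.Ico (0:ℝ) T, ∀ z ∈ Metric.ball (0:ℂ) 1,
      HasDerivAt (fun x => p' x t) (p'' z t) z)
    (hp'_cont : ∀ t ∈ Set.Ico (0:ℝ) T,
      ContinuousOn (fun z => p' z t) (Metric.closedBall (0:ℂ) 1))
    (hp''_cont : ∀ t ∈ Set.Ico (0:ℝ) T,
      ContinuousOn (fun z => p'' z t) (Metric.closedBall (0:ℂ) 1))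
    (hp_t : ∀ z ∈ Metric.closedBall (0:ℂ) 1, ContinuousOn (fun t => p z t) (Set.Ico 0 T))
    (M M' M'' : ℝ)
    (hp_bdd : ∀ z ∈ Metric.closedBall (0:ℂ) 1, ∀ t ∈ Set.Ico (0:ℝ) T, ‖p z t‖ ≤ M)
    (hp'_bdd : ∀ z ∈ Metric.closedBall (0:ℂ) 1, ∀ t ∈ Set.Ico (0:ℝ) T, ‖p' z t‖ ≤ M')
    (hp''_bdd : ∀ z ∈ Metric.closedBall (0:ℂ) 1, ∀ t ∈ Set.Ico (0:ℝ) T, ‖p'' z t‖ ≤ M'')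
    -- interior maps: f solves the Löwner–Kufarev PDE, f(z,0) = z, each f(·,t)
    -- univalent on 𝔻 and continuous on 𝔻̄
    (f fz : ℂ → ℝ → ℂ)
    (hf_init : ∀ z ∈ Metric.ball (0:ℂ) 1, f z 0 = z)
    (hf_hol : ∀ t ∈ Set.Ico (0:ℝ) T,
      DifferentiableOn ℂ (fun z => f z t) (Metric.ball (0:ℂ) 1))
    (hf_inj : ∀ t ∈ Set.Ico (0:ℝ) T,
      Set.InjOn (fun z => f z t) (Metric.ball (0:ℂ) 1))
    (hf_cl : ∀ t ∈ Set.Ico (0:ℝ) T,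
      ContinuousOn (fun z => f z t) (Metric.closedBall (0:ℂ) 1))
    (hfz : ∀ t ∈ Set.Ico (0:ℝ) T, ∀ z ∈ Metric.ball (0:ℂ) 1,
      HasDerivAt (fun x => f x t) (fz z t) z)
    (hf_pde : ∀ z ∈ Metric.ball (0:ℂ) 1, ∀ t ∈ Set.Ico (0:ℝ) T,
      HasDerivWithinAt (fun u => f z u) (-(z * fz z t * p z t)) (Set.Ico 0 T) t)
    -- Ω*(t): the unbounded connected component of the complement of
    -- Γ(t) = f(𝕋,t)
    (Ωstar : ℝ → Set ℂ)
    (hΩstar : ∀ t ∈ Set.Ico (0:ℝ) T, ∃ x : ℂ,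
      ¬ Bornology.IsBounded
        (connectedComponentIn ((fun z => f z t) '' Metric.sphere (0:ℂ) 1)ᶜ x) ∧
      Ωstar t = connectedComponentIn ((fun z => f z t) '' Metric.sphere (0:ℂ) 1)ᶜ x)
    -- the time change τ, differentiable with τ(0) = 0 and τ' > 0
    (τ τd : ℝ → ℝ)
    (hτ_init : τ 0 = 0)
    (hτd : ∀ t ∈ Set.Ico (0:ℝ) T, HasDerivWithinAt τ (τd t) (Set.Ico 0 T) t)
    (hτd_pos : ∀ t ∈ Set.Ico (0:ℝ) T, 0 < τd t)
    -- exterior maps: F(·,τ(t)) maps 𝔻* = {|z| > 1} injectively and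
    -- holomorphically onto Ω*(t), extends continuously to 𝕋 with
    -- F(𝕋,τ(t)) = f(𝕋,t), and F(z,τ) = e^{-τ}z + b₀(τ) + O(1/z) at ∞
    (F Fz : ℂ → ℝ → ℂ) (b₀ : ℝ → ℂ)
    (hF_hol : ∀ t ∈ Set.Ico (0:ℝ) T,
      DifferentiableOn ℂ (fun z => F z (τ t)) {z : ℂ | 1 < ‖z‖})
    (hF_inj : ∀ t ∈ Set.Ico (0:ℝ) T,
      Set.InjOn (fun z => F z (τ t)) {z : ℂ | 1 < ‖z‖})
    (hF_onto : ∀ t ∈ Set.Ico (0:ℝ) T,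
      (fun z => F z (τ t)) '' {z : ℂ | 1 < ‖z‖} = Ωstar t)
    (hF_cl : ∀ t ∈ Set.Ico (0:ℝ) T,
      ContinuousOn (fun z => F z (τ t)) {z : ℂ | 1 ≤ ‖z‖})
    (hF_exp : ∀ t ∈ Set.Ico (0:ℝ) T,
      Tendsto (fun z : ℂ => F z (τ t) - Complex.exp (-(τ t : ℂ)) * z)
        (Bornology.cobounded ℂ) (𝓝 (b₀ (τ t))))
    (hF_weld_set : ∀ t ∈ Set.Ico (0:ℝ) T,
      (fun z => F z (τ t)) '' Metric.sphere (0:ℂ) 1 =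
        (fun z => f z t) '' Metric.sphere (0:ℂ) 1)
    (hFz : ∀ t ∈ Set.Ico (0:ℝ) T, ∀ z ∈ {z : ℂ | 1 < ‖z‖},
      HasDerivAt (fun x => F x (τ t)) (Fz z (τ t)) z)
    -- exterior Löwner–Kufarev equation with driving function q, holomorphic on
    -- 𝔻*, q(z,t) → 1 as z → ∞, Re q > 0 on 𝔻*
    (q : ℂ → ℝ → ℂ)
    (hq_hol : ∀ t ∈ Set.Ico (0:ℝ) T,
      DifferentiableOn ℂ (fun z => q z t) {z : ℂ | 1 < ‖z‖})
    (hq_lim : ∀ t ∈ Set.Ico (0:ℝ) T,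
      Tendsto (fun z => q z t) (Bornology.cobounded ℂ) (𝓝 1))
    (hq_re : ∀ t ∈ Set.Ico (0:ℝ) T, ∀ z ∈ {z : ℂ | 1 < ‖z‖}, 0 < (q z t).re)
    (hF_pde : ∀ z ∈ {z : ℂ | 1 < ‖z‖}, ∀ t ∈ Set.Ico (0:ℝ) T,
      HasDerivWithinAt (fun u => F z (τ u))
        (-(z * Fz z (τ t) * q z t * τd t)) (Set.Ico 0 T) t)
    -- q extends continuously up to the unit circle
    (hq_cl : ∀ t ∈ Set.Ico (0:ℝ) T,
      ContinuousOn (fun z => q z t) {z : ℂ | 1 ≤ ‖z‖}) :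
    (∀ ζ : ℂ, 1 < ‖ζ‖ →
      q ζ 0 = starRingEnd ℂ (p ((starRingEnd ℂ ζ)⁻¹) 0)) ∧
    (∀ z ∈ Metric.ball (0:ℂ) 1, z ≠ 0 →
      starRingEnd ℂ (p (starRingEnd ℂ z) 0) = q z⁻¹ 0) := by
  have h0T : (0 : ℝ) ∈ Set.Ico 0 T := ⟨le_rfl, hT⟩
  have h0b : (0 : ℂ) ∈ Metric.ball (0 : ℂ) 1 := Metric.mem_ball_self one_pos
  have hbc : Metric.ball (0 : ℂ) 1 ⊆ Metric.closedBall 0 1 := Metric.ball_subset_closedBall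
  have hinv : ∀ w ∈ Metric.ball (0 : ℂ) 1, w ≠ 0 → 1 < ‖w⁻¹‖ := fun w hw hw0 => by
    rw [norm_inv]
    exact (one_lt_inv₀ (norm_pos_iff.2 hw0)).2 (mem_ball_zero_iff.1 hw)
  -- the inverted exterior maps
  set G : ℝ → ℂ → ℂ := fun t =>
    Function.update (fun w => w * F w⁻¹ (τ t)) 0 (Complex.exp (-(τ t : ℂ)))
  have hGreg : ∀ t ∈ Set.Ico (0 : ℝ) T, ContinuousOn (G t) (Metric.closedBall 0 1) ∧
      DifferentiableOn ℂ (G t) (Metric.ball 0 1) := fun t ht =>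
    inversion_regular (hF_hol t ht) (hF_cl t ht) (hF_exp t ht)
  have hG0 : ∀ t, G t 0 = Complex.exp (-(τ t : ℂ)) := fun t => Function.update_self _ _ _
  have hGne : ∀ t, ∀ w : ℂ, w ≠ 0 → G t w = w * F w⁻¹ (τ t) := fun t w hw =>
    Function.update_of_ne hw _ _
  have hGcirc : ∀ t ∈ Set.Ico (0 : ℝ) T, ∀ ω ∈ Metric.sphere (0 : ℂ) 1,
      ∃ ζ ∈ Metric.sphere (0 : ℂ) 1, starRingEnd ℂ ω * G t ω = f ζ t := fun t ht ω hω => by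
    have hω1 : ‖ω‖ = 1 := mem_sphere_zero_iff_norm.1 hω
    have hω0 : ω ≠ 0 := norm_pos_iff.1 (by rw [hω1]; exact one_pos)
    have hmem : F ω⁻¹ (τ t) ∈ (fun z => f z t) '' Metric.sphere (0 : ℂ) 1 := by
      rw [← hF_weld_set t ht]
      exact ⟨ω⁻¹, by simp [hω1], rfl⟩
    obtain ⟨ζ, hζ, hζe⟩ := hmem
    refine ⟨ζ, hζ, ?_⟩
    rw [hGne t ω hω0, ← mul_assoc, Complex.conj_mul', hω1]
    simpa using hζe.symm
  have hGnz : ∀ t ∈ Set.Ico (0 : ℝ) T, ∀ w ∈ Metric.ball (0 : ℂ) 1, G t w ≠ 0 :=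
      fun t ht w hw => by
    by_cases hw0 : w = 0
    · rw [hw0, hG0]
      exact Complex.exp_ne_zero _
    · rw [hGne t w hw0]
      refine mul_ne_zero hw0 fun hzero => ?_
      obtain ⟨x, hx, hxe⟩ := hΩstar t ht
      have hmem : F w⁻¹ (τ t) ∈ Ωstar t := by
        rw [← hF_onto t ht]
        exact ⟨w⁻¹, hinv w hw hw0, rfl⟩
      have hf00 := loewner_kufarev_apply_zero (hf_init 0 h0b) hf_pde ht
      have hnot := image_notMem_connectedComponentIn_of_not_isBounded (hf_hol t ht) (hf_cl t ht)
        (hf_inj t ht) hx h0b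
      simp only [hf00] at hnot
      rw [hzero, hxe] at hmem
      exact hnot hmem
  -- the exterior map at time zero is the identity
  have hf0 : ∀ ζ ∈ Metric.closedBall (0 : ℂ) 1, f ζ 0 = ζ := by
    intro ζ hζ
    have hcl := closure_ball (0 : ℂ) one_ne_zero
    rw [← hcl] at hζ
    exact Set.EqOn.of_subset_closure (s := Metric.ball (0 : ℂ) 1) (t := closure (Metric.ball 0 1))
      (f := fun z => f z 0) (g := fun z => z) hf_init (by rw [hcl]; exact hf_cl 0 h0T)
      continuousOn_id subset_closure subset_rfl hζ
  have hG1 : ∀ w ∈ Metric.ball (0 : ℂ) 1, G 0 w = 1 := by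
    refine eqOn_one_of_norm_eq_one (hGreg 0 h0T).1 (hGreg 0 h0T).2 (fun ω hω => ?_) ?_
    · obtain ⟨ζ, hζ, hζe⟩ := hGcirc 0 h0T ω hω
      rw [hf0 ζ (Metric.sphere_subset_closedBall hζ)] at hζe
      have := congrArg norm hζe
      rwa [norm_mul, Complex.norm_conj, mem_sphere_zero_iff_norm.1 hω, one_mul,
        mem_sphere_zero_iff_norm.1 hζ] at this
    · rw [hG0, hτ_init]
      simp
  have hF0 : ∀ z : ℂ, 1 < ‖z‖ → F z (τ 0) = z := fun z hz => by
    have hz0 : z ≠ 0 := norm_pos_iff.1 (by linarith)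
    have hzb : z⁻¹ ∈ Metric.ball (0 : ℂ) 1 := by
      rw [mem_ball_zero_iff, norm_inv]
      exact inv_lt_one_of_one_lt₀ hz
    have h1 := hG1 z⁻¹ hzb
    rw [hGne 0 _ (inv_ne_zero hz0), inv_inv] at h1
    field_simp at h1
    exact h1
  have hFz0 : ∀ z : ℂ, 1 < ‖z‖ → Fz z (τ 0) = 1 := fun z hz => by
    have hev : (fun x => F x (τ 0)) =ᶠ[𝓝 z] fun x => x := by
      filter_upwards [(isOpen_lt continuous_const continuous_norm).mem_nhds hz] with x hx
      exact hF0 x hx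
    exact ((hFz 0 h0T z hz).congr_of_eventuallyEq hev.symm).unique (hasDerivAt_id' z)
  -- the first order expansion of the exterior maps
  have hM1 : ∀ z ∈ Metric.closedBall (0 : ℂ) 1, ‖p z 0‖ ≤ max M 1 := fun z hz =>
    (hp_bdd z hz 0 h0T).trans (le_max_left _ _)
  have hLip : ∀ z ∈ Metric.closedBall (0 : ℂ) 1, ∀ z' ∈ Metric.closedBall (0 : ℂ) 1,
      ‖p z 0 - p z' 0‖ ≤ max M' 1 * ‖z - z'‖ := fun z hz z' hz' => by
    have hnn : 0 ≤ max M' 1 := le_max_of_le_right zero_le_one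
    have h1 := lipschitzOnWith_closedBall_of_hasDerivAt (K := ⟨max M' 1, hnn⟩) (hp_cont 0 h0T)
      (hp' 0 h0T) fun z hz => (hp'_bdd z (hbc hz) 0 h0T).trans (le_max_left _ _)
    have h2 := h1.dist_le_mul z hz z' hz'
    rwa [dist_eq_norm, dist_eq_norm] at h2
  have hlim : ∀ w ∈ Metric.ball (0 : ℂ) 1, Tendsto (fun t : ℝ => (G t w - 1) / t) (𝓝[>] 0)
      (𝓝 (-starRingEnd ℂ (p (starRingEnd ℂ w) 0))) := fun w hw => by
    have hw1 : 0 < 1 - ‖w‖ := sub_pos.2 (mem_ball_zero_iff.1 hw)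
    refine tendsto_slope_of_log (C := 2 / (1 - ‖w‖) * (452 * max M' 1 ^ 2)) (by positivity)
      fun ε hε hε1 => ?_
    obtain ⟨δ, hδ, hδT, hexp⟩ := loewner_kufarev_expansion hT hp_cont hp_re hp' hp_t hp_bdd
      hp'_bdd hf_init hf_hol hf_inj hf_cl hfz hf_pde hε
    have hMpos : 0 < max M 1 := lt_max_of_lt_right one_pos
    filter_upwards [self_mem_nhdsWithin, nhdsWithin_le_nhds (Iio_mem_nhds
      (show 0 < min δ (ε / (8 * max M 1 ^ 2)) by positivity))] with t ht htlt
    have ht0 : 0 < t := ht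
    have htlt' : t < min δ (ε / (8 * max M 1 ^ 2)) := htlt
    have htδ : t < δ := htlt'.trans_le (min_le_left _ _)
    have htM := (lt_div_iff₀ (by positivity)).1 (htlt'.trans_le (min_le_right _ _))
    have htT : t ∈ Set.Ico 0 T := ⟨ht0.le, htδ.trans hδT⟩
    obtain ⟨l, hl, hle⟩ := exists_log_norm_sq_le (p := fun z => p z 0) (le_max_right M 1)
      (le_max_right M' 1) hε hε1 ht0 (by linarith) (hp_hol 0 h0T) hM1 hLip (hp_one 0 h0T)
      (hGreg t htT).1 (hGreg t htT).2 (hGnz t htT) (hG0 t).symm (fun ω hω => by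
        obtain ⟨ζ, hζ, hζe⟩ := hGcirc t htT ω hω
        refine ⟨ζ, hζ, ?_⟩
        rw [hζe]
        exact hexp t ⟨ht0.le, htδ.le⟩ ζ (Metric.sphere_subset_closedBall hζ)) hw
    exact ⟨l, hl, hle.trans_eq (by ring)⟩
  have hrel : ∀ w ∈ Metric.ball (0 : ℂ) 1, w ≠ 0 →
      starRingEnd ℂ (p (starRingEnd ℂ w) 0) = q w⁻¹ 0 * τd 0 := fun w hw hw0 => by
    have hwi := hinv w hw hw0
    have h1 := ((hF_pde w⁻¹ hwi 0 h0T).mono_of_mem_nhdsWithin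
      (Ico_mem_nhdsGE hT)).mono Set.Ioi_subset_Ici_self
    have h2 := (hasDerivWithinAt_iff_tendsto_slope' (by simp)).1 (h1.const_mul w)
    have h3 := tendsto_nhds_unique ((hlim w hw).congr' ?_) h2
    · rw [hFz0 _ hwi] at h3
      have h4 := neg_inj.1 (h3.trans (mul_neg _ _))
      rw [h4]
      field_simp
    · filter_upwards with t
      rw [slope_def_module, ← hGne t w hw0, ← hGne 0 w hw0, hG1 w hw, sub_zero, Complex.real_smul,
        Complex.ofReal_inv, div_eq_inv_mul]
  have hτ1 : (τd 0 : ℂ) = 1 := by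
    have h1 : Tendsto (fun w : ℂ => q w⁻¹ 0 * τd 0) (𝓝[≠] 0) (𝓝 (1 * τd 0)) :=
      ((hq_lim 0 h0T).comp tendsto_inv₀_nhdsNE_zero).mul_const _
    have hpc : ContinuousAt (fun w : ℂ => starRingEnd ℂ (p (starRingEnd ℂ w) 0)) 0 := by
      have hp0 : ContinuousAt (fun z => p z 0) (starRingEnd ℂ 0) := by
        rw [map_zero]
        exact (hp_cont 0 h0T).continuousAt (Metric.closedBall_mem_nhds 0 one_pos)
      exact Complex.continuous_conj.continuousAt.comp
        (hp0.comp Complex.continuous_conj.continuousAt)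
    have h2 := hpc.tendsto.mono_left (nhdsWithin_le_nhds (s := {0}ᶜ))
    rw [map_zero, hp_one 0 h0T, map_one] at h2
    rw [one_mul] at h1
    refine tendsto_nhds_unique (h1.congr' ?_) h2
    filter_upwards [self_mem_nhdsWithin, nhdsWithin_le_nhds (Metric.ball_mem_nhds 0 one_pos)]
      with w hw0 hw
    exact (hrel w hw hw0).symm
  have hmain : ∀ z ∈ Metric.ball (0 : ℂ) 1, z ≠ 0 →
      starRingEnd ℂ (p (starRingEnd ℂ z) 0) = q z⁻¹ 0 := fun z hz hz0 => by
    rw [hrel z hz hz0, hτ1, mul_one]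
  refine ⟨fun ζ hζ => ?_, hmain⟩
  have hζ0 : ζ ≠ 0 := norm_pos_iff.1 (by linarith)
  have h1 := hmain ζ⁻¹ (by
    rw [mem_ball_zero_iff, norm_inv]
    exact inv_lt_one_of_one_lt₀ hζ) (inv_ne_zero hζ0)
  rw [inv_inv, map_inv₀] at h1
  exact h1.symm
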